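/- arXiv:math/0607805 — 3 statements merged into one kernel-verified Lean document; each statement's English description precedes it below -/
import Mathlib

section
/- Consider Bernoulli site percolation on ℤ^d, d ≥ 2, and fix κ ∈ (0,1). Then for p < 1 sufficiently large there exists a constant c > 0 such that P_p(𝒜_n ∩ ℬ_n ∩ 𝒞_n(κ)) ≥ 1 − e^{−cn} for all n ≥ 1. -/
open MeasureTheory Filter
open scoped ENNReal

noncomputable section

abbrev Site (d : ℕ) := Fin d → ℤ
abbrev PConfig (d : ℕ) := Site d → Bool

/-- Bernoulli(p) site percolation measure on `ℤ^d`, characterized by its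
cylinder probabilities. -/
def IsBernoulliPerc (d : ℕ) (p : ℝ) (μ : Measure (PConfig d)) : Prop :=
  IsProbabilityMeasure μ ∧
  ∀ (S : Finset (Site d)) (b : Site d → Bool),
    μ {ω | ∀ x ∈ S, ω x = b x} = ∏ x ∈ S, ENNReal.ofReal (if b x then p else 1 - p)

/-- the box `B_n = {1,…,n}^d`. -/
def percBox (d n : ℕ) : Set (Site d) := {x | ∀ i, 1 ≤ x i ∧ x i ≤ (n : ℤ)}

/-- nearest-neighbour adjacency on `ℤ^d` (Euclidean distance one). -/
def percAdj {d : ℕ} (x y : Site d) : Prop := (∑ i, (x i - y i) ^ 2) = 1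

/-- one step between open sites of the box. -/
def percStep (d n : ℕ) (ω : PConfig d) (x y : Site d) : Prop :=
  x ∈ percBox d n ∧ y ∈ percBox d n ∧ ω x = true ∧ ω y = true ∧ percAdj x y

/-- `C` is an open cluster of `B_n`: a nonempty, connected, maximal set of open sites. -/
def IsCluster (d n : ℕ) (ω : PConfig d) (C : Set (Site d)) : Prop :=
  C.Nonempty ∧ (∀ x ∈ C, x ∈ percBox d n ∧ ω x = true) ∧
  (∀ x ∈ C, ∀ y ∈ C, Relation.ReflTransGen (percStep d n ω) x y) ∧
  (∀ x ∈ C, ∀ y, percStep d n ω x y → y ∈ C)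

/-- `C` is an open cluster of maximal cardinality in `B_n`. -/
def IsMaxCluster (d n : ℕ) (ω : PConfig d) (C : Set (Site d)) : Prop :=
  IsCluster d n ω C ∧ ∀ C' : Set (Site d), IsCluster d n ω C' → C'.ncard ≤ C.ncard

/-- `ℓ^∞` distance on `ℤ^d`. -/
def linfD {d : ℕ} (x y : Site d) : ℕ := Finset.univ.sup fun i => (x i - y i).natAbs

/-- the (ℓ^∞) diameter of `C` is at least `⌊n/10⌋`. -/
def bigDiam (d n : ℕ) (C : Set (Site d)) : Prop := ∃ x ∈ C, ∃ y ∈ C, n / 10 ≤ linfD x y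

/-- event `𝒜_n`: at most one open cluster of diameter `≥ ⌊n/10⌋`. -/
def eventA (d n : ℕ) : Set (PConfig d) :=
  {ω | ∀ C C' : Set (Site d), IsCluster d n ω C → IsCluster d n ω C' →
    bigDiam d n C → bigDiam d n C' → C = C'}

/-- event `ℬ_n`: there is an open crossing cluster. -/
def eventB (d n : ℕ) : Set (PConfig d) :=
  {ω | ∃ C : Set (Site d), IsCluster d n ω C ∧
    ∀ j : Fin d, (∃ x ∈ C, x j = 1) ∧ (∃ x ∈ C, x j = (n : ℤ))}

/-- event `𝒞_n(κ)`: there is an open cluster with at least `κ n^d` points. -/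
def eventC (d n : ℕ) (κ : ℝ) : Set (PConfig d) :=
  {ω | ∃ C : Set (Site d), IsCluster d n ω C ∧ κ * (n : ℝ) ^ d ≤ (C.ncard : ℝ)}

/-- Two sites at `ℓ^∞` distance at most one. -/
def starAdj {d : ℕ} (x y : Site d) : Prop := ∀ i, |x i - y i| ≤ 1

/-- One step of a closed `ℓ^∞` path in the box. -/
def closedStep (d n : ℕ) (ω : PConfig d) (x y : Site d) : Prop :=
  x ∈ percBox d n ∧ y ∈ percBox d n ∧ ω x = false ∧ ω y = false ∧ starAdj x y

/-- The closed sites joined by a closed `ℓ^∞` path to the line through `v` in direction `e`. -/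
def lineHull (d n : ℕ) (ω : PConfig d) (e : Fin d) (v : Site d) : Set (Site d) :=
  {x | ∃ y ∈ percBox d n, ω y = false ∧ (∀ j, j ≠ e → y j = v j) ∧
    Relation.ReflTransGen (closedStep d n ω) y x}

/-- A closed 1-cochain on the box is exact. -/
theorem exists_potential {d n : ℕ} (F : Fin d → Site d → ℤ)
    (hF : ∀ i j x, x ∈ percBox d n → x + Pi.single i 1 + Pi.single j 1 ∈ percBox d n →
      F i x + F j (x + Pi.single i 1) = F j x + F i (x + Pi.single j 1)) :
    ∃ g : Site d → ℤ, ∀ i x, x ∈ percBox d n → x + Pi.single i 1 ∈ percBox d n →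
      g (x + Pi.single i 1) = g x + F i x := by
  suffices H : ∀ k : ℕ, ∃ g : Site d → ℤ, ∀ i : Fin d, i.val < k → ∀ x, x ∈ percBox d n →
      x + Pi.single i 1 ∈ percBox d n → g (x + Pi.single i 1) = g x + F i x by
    obtain ⟨g, hg⟩ := H d
    exact ⟨g, fun i => hg i i.2⟩
  intro k
  induction k with
  | zero => exact ⟨0, fun i hi => absurd hi (Nat.not_lt_zero _)⟩
  | succ k ih =>
    obtain ⟨g, hg⟩ := ih
    by_cases hk : k < d
    swap
    · exact ⟨g, fun i hi => hg i (by omega)⟩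
    set a : Fin d := ⟨k, hk⟩ with ha
    set G : Site d → ℤ := fun x => F a x - (g (x + Pi.single a 1) - g x) with hG
    refine ⟨fun x => g x + ∑ t ∈ Finset.Ico 1 (x a), G (Function.update x a t), ?_⟩
    intro i hi x hx hxi
    by_cases hia : i = a
    · subst hia
      have h1 : ∀ t, Function.update (x + Pi.single a 1) a t = Function.update x a t := by
        intro t
        ext j
        by_cases hj : j = a
        · subst hj; simp
        · simp [hj]
      have h2 : Finset.Ico 1 (x a + 1) = insert (x a) (Finset.Ico 1 (x a)) := by
        have := (hx a).1
        ext t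
        simp only [Finset.mem_Ico, Finset.mem_insert]
        omega
      simp only [h1, Pi.add_apply, Pi.single_eq_same, h2]
      rw [Finset.sum_insert (by simp), Function.update_eq_self]
      simp only [hG]
      ring
    · have hik : i.val < k := by
        have : i.val ≠ k := fun h => hia (Fin.ext h)
        omega
      have h0 : (x + Pi.single i 1 : Site d) a = x a := by
        simp [Ne.symm hia]
      have h1 : ∀ t ∈ Finset.Ico 1 (x a), G (Function.update (x + Pi.single i 1) a t)
          = G (Function.update x a t) := by
        intro t ht
        rw [Finset.mem_Ico] at ht
        have hy : Function.update (x + Pi.single i 1) a t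
            = Function.update x a t + Pi.single i 1 := by
          ext j
          by_cases hj : j = a
          · subst hj; simp [Ne.symm hia]
          · simp [hj]
        rw [hy]
        set y := Function.update x a t with hydef
        have hya : y a = t := by simp [hydef]
        have hyj : ∀ j, j ≠ a → y j = x j := fun j hj => by simp [hydef, hj]
        have b0 : y ∈ percBox d n := by
          intro j
          by_cases hj : j = a
          · subst hj; have := hx a; rw [hya]; omega
          · rw [hyj j hj]; exact hx j
        have b1 : y + Pi.single i 1 ∈ percBox d n := by
          intro j
          by_cases hj : j = a
          · subst hj; have := hx a; simp [Ne.symm hia, hya]; omega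
          · have := hxi j
            simpa [hyj j hj] using this
        have b2 : y + Pi.single a 1 ∈ percBox d n := by
          intro j
          by_cases hj : j = a
          · subst hj; have := hx a; simp [hya]; omega
          · simpa [hj, hyj j hj] using hx j
        have b3 : y + Pi.single i 1 + Pi.single a 1 ∈ percBox d n := by
          intro j
          by_cases hj : j = a
          · subst hj; have := hx a; simp [Ne.symm hia, hya]; omega
          · simpa [hj, hyj j hj] using hxi j
        have e0 := hF i a y b0 b3
        have e1 := hg i hik y b0 b1
        have e2 := hg i hik (y + Pi.single a 1) b2 (by rwa [add_right_comm])
        rw [add_right_comm] at e2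
        simp only [hG]
        linarith
      simp only [h0]
      rw [Finset.sum_congr rfl h1, hg i hik x hx hxi]
      ring

theorem percAdj_symm {d : ℕ} {x y : Site d} (h : percAdj x y) : percAdj y x := by
  unfold percAdj at *
  rw [← h]
  exact Finset.sum_congr rfl fun i _ => by ring

theorem percAdj_add_single {d : ℕ} (x : Site d) (i : Fin d) : percAdj x (x + Pi.single i 1) := by
  unfold percAdj
  simp [Pi.single_apply, ite_pow]

theorem percAdj_iff {d : ℕ} {x y : Site d} :
    percAdj x y ↔ ∃ i, y = x + Pi.single i 1 ∨ x = y + Pi.single i 1 := by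
  constructor
  · intro h
    unfold percAdj at h
    have h0 : ∃ i, x i - y i ≠ 0 := by
      by_contra! hc
      simp [hc] at h
    obtain ⟨i, hi⟩ := h0
    rw [← Finset.add_sum_erase _ _ (Finset.mem_univ i)] at h
    have hpos : 0 < (x i - y i) ^ 2 := by positivity
    have hnn : ∀ j ∈ Finset.univ.erase i, 0 ≤ (x j - y j) ^ 2 := fun j _ => sq_nonneg _
    have hs := Finset.sum_nonneg hnn
    have hz : ∑ j ∈ Finset.univ.erase i, (x j - y j) ^ 2 = 0 := by omega
    have h1 : (x i - y i) ^ 2 = 1 := by omega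
    rw [Finset.sum_eq_zero_iff_of_nonneg hnn] at hz
    have hz' : ∀ j, j ≠ i → x j = y j := by
      intro j hj
      have := hz j (by simp [hj])
      have := pow_eq_zero_iff (two_ne_zero) |>.1 this
      omega
    refine ⟨i, ?_⟩
    rcases (show x i - y i = 1 ∨ x i - y i = -1 from by simpa using h1) with h2 | h2
    · right
      ext j
      by_cases hj : j = i
      · subst hj; simp; omega
      · simp [hj, hz' j hj]
    · left
      ext j
      by_cases hj : j = i
      · subst hj; simp; omega
      · simp [hj, hz' j hj]
  · rintro ⟨i, rfl | rfl⟩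
    · exact percAdj_add_single _ _
    · exact percAdj_symm (percAdj_add_single _ _)

/-- The connected component of `z` in the complement of `C` in the box. -/
def outComp (d n : ℕ) (C : Set (Site d)) (z : Site d) : Set (Site d) :=
  {y | Relation.ReflTransGen
    (fun x y => (x ∈ percBox d n ∧ x ∉ C) ∧ (y ∈ percBox d n ∧ y ∉ C) ∧ percAdj x y) z y}

/-- The sites of `outComp d n C z` adjacent to `C`. -/
def outBdry (d n : ℕ) (C : Set (Site d)) (z : Site d) : Set (Site d) :=
  {x | x ∈ outComp d n C z ∧ ∃ y ∈ C, percAdj x y}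

/-- The coordinate projection of a set of sites. -/
def coordProj {d : ℕ} (A : Set (Site d)) (i : Fin d) : Set ℤ := (fun x : Site d => x i) '' A

section Geometry

variable {d n : ℕ} {ω : PConfig d} {C : Set (Site d)} {z : Site d}

theorem percBox_finite (d n : ℕ) : (percBox d n).Finite := by
  refine (Set.Finite.pi' (fun _ : Fin d => Set.finite_Icc (1 : ℤ) n)).subset ?_
  intro x hx i
  exact hx i

theorem outComp_mem (hz : z ∈ percBox d n ∧ z ∉ C) {y : Site d} (hy : y ∈ outComp d n C z) :
    y ∈ percBox d n ∧ y ∉ C := by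
  induction hy with
  | refl => exact hz
  | tail _ h _ => exact h.2.1

theorem outComp_self : z ∈ outComp d n C z := Relation.ReflTransGen.refl

theorem mem_of_adj_outComp (hz : z ∈ percBox d n ∧ z ∉ C) {x y : Site d}
    (hx : x ∈ outComp d n C z) (hy : y ∈ percBox d n) (hxy : percAdj x y)
    (hyD : y ∉ outComp d n C z) : y ∈ C := by
  by_contra hyC
  exact hyD (Relation.ReflTransGen.tail hx ⟨outComp_mem hz hx, ⟨hy, hyC⟩, hxy⟩)

theorem outBdry_closed (hC : IsCluster d n ω C) (hz : z ∈ percBox d n ∧ z ∉ C) {x : Site d}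
    (hx : x ∈ outBdry d n C z) : ω x = false := by
  obtain ⟨hxD, y, hy, hxy⟩ := hx
  obtain ⟨hxB, hxC⟩ := outComp_mem hz hxD
  by_contra h
  exact hxC (hC.2.2.2 y hy x ⟨(hC.2.1 y hy).1, hxB, (hC.2.1 y hy).2, by simpa using h,
    percAdj_symm hxy⟩)

theorem outBdry_subset_box (hz : z ∈ percBox d n ∧ z ∉ C) :
    outBdry d n C z ⊆ percBox d n := fun _ hx => (outComp_mem hz hx.1).1

open Classical in
/-- The boundary of a complementary component of a cluster is `ℓ^∞`-connected. -/
theorem outBdry_connected (hC : IsCluster d n ω C) (hz : z ∈ percBox d n ∧ z ∉ C)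
    {a b : Site d} (ha : a ∈ outBdry d n C z) (hb : b ∈ outBdry d n C z) :
    Relation.ReflTransGen (closedStep d n ω) a b := by
  set D := outComp d n C z with hD
  set A : Set (Site d) :=
    {x | x ∈ outBdry d n C z ∧ Relation.ReflTransGen (closedStep d n ω) a x} with hA
  have hAD : ∀ x ∈ A, x ∈ D := fun x hx => hx.1.1
  have hDC : ∀ x ∈ D, x ∉ C := fun x hx => (outComp_mem hz hx).2
  have hnear : ∀ p ∈ A, ∀ q ∈ outBdry d n C z, starAdj p q → q ∈ A := by
    intro p hp q hq hpq
    exact ⟨hq, hp.2.tail ⟨outBdry_subset_box hz hp.1, outBdry_subset_box hz hq,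
      outBdry_closed hC hz hp.1, outBdry_closed hC hz hq, hpq⟩⟩
  set φ : Site d → Site d → ℤ := fun x y =>
    (if x ∈ C ∧ y ∈ A then 1 else 0) - (if x ∈ A ∧ y ∈ C then 1 else 0) with hφ
  have hanti : ∀ x y, φ x y = - φ y x := by
    intro x y
    simp only [hφ, and_comm]
    ring
  have hzero : ∀ x y, x ∉ A → y ∉ A → φ x y = 0 := by
    intro x y hx hy
    simp [hφ, hx, hy]
  have htel : ∀ p ∈ A, ∀ x y, x ∈ percBox d n → y ∈ percBox d n → percAdj x y → starAdj p x →
      starAdj p y → φ x y = (if y ∈ D then 1 else 0) - (if x ∈ D then 1 else 0) := by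
    intro p hp x y hx hy hxy hpx hpy
    by_cases h1 : x ∈ D <;> by_cases h2 : y ∈ D
    · simp [hφ, h1, h2, hDC x h1, hDC y h2]
    · have hyC := mem_of_adj_outComp hz h1 hy hxy h2
      have hxA : x ∈ A := hnear p hp x ⟨h1, y, hyC, hxy⟩ hpx
      simp [hφ, h1, h2, hDC x h1, hyC, hxA]
    · have hxC := mem_of_adj_outComp hz h2 hx (percAdj_symm hxy) h1
      have hyA : y ∈ A := hnear p hp y ⟨h2, x, hxC, percAdj_symm hxy⟩ hpy
      simp [hφ, h1, h2, hDC y h2, hxC, hyA]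
    · have h1' : x ∉ A := fun h => h1 (hAD x h)
      have h2' : y ∉ A := fun h => h2 (hAD y h)
      simp [hφ, h1, h2, h1', h2']
  obtain ⟨g, hg⟩ := exists_potential (d := d) (n := n) (fun i x => φ x (x + Pi.single i 1)) (by
    intro i j x hx hxij
    by_cases hij : i = j
    · subst hij; rfl
    have hji : j ≠ i := Ne.symm hij
    have hxi : x + Pi.single i 1 ∈ percBox d n := by
      intro k
      have h1 := hx k
      have h2 := hxij k
      simp only [Pi.add_apply, Pi.single_apply] at h2 ⊢
      split_ifs at h2 ⊢ <;> omega
    have hxj : x + Pi.single j 1 ∈ percBox d n := by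
      intro k
      have h1 := hx k
      have h2 := hxij k
      simp only [Pi.add_apply, Pi.single_apply] at h2 ⊢
      split_ifs at h2 ⊢ <;> omega
    have hcomm : x + Pi.single j 1 + Pi.single i 1 = x + Pi.single i 1 + Pi.single j 1 :=
      add_right_comm _ _ _
    simp only [hcomm]
    have a1 := percAdj_add_single x i
    have a2 := percAdj_add_single x j
    have a3 := percAdj_add_single (x + Pi.single i 1) j
    have a4 := percAdj_add_single (x + Pi.single j 1) i
    rw [hcomm] at a4
    set u := x + Pi.single i 1 with hu
    set v := x + Pi.single j 1 with hv
    set w := u + Pi.single j 1 with hw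
    have c0 : ∀ k, x k ≤ x k ∧ x k ≤ x k + 1 := fun k => by omega
    have c1 : ∀ k, x k ≤ u k ∧ u k ≤ x k + 1 := fun k => by
      simp only [hu, Pi.add_apply, Pi.single_apply]; split_ifs <;> omega
    have c2 : ∀ k, x k ≤ v k ∧ v k ≤ x k + 1 := fun k => by
      simp only [hv, Pi.add_apply, Pi.single_apply]; split_ifs <;> omega
    have c3 : ∀ k, x k ≤ w k ∧ w k ≤ x k + 1 := fun k => by
      simp only [hw, hu, Pi.add_apply, Pi.single_apply]
      split_ifs <;> omega
    have cadj : ∀ p q : Site d, (∀ k, x k ≤ p k ∧ p k ≤ x k + 1) →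
        (∀ k, x k ≤ q k ∧ q k ≤ x k + 1) → starAdj p q := by
      intro p q hp hq k
      have := hp k
      have := hq k
      rw [abs_le]; omega
    by_cases hex : ∃ p ∈ A, ∀ k, x k ≤ p k ∧ p k ≤ x k + 1
    · obtain ⟨p, hp, hpc⟩ := hex
      rw [htel p hp x u hx hxi a1 (cadj _ _ hpc c0) (cadj _ _ hpc c1),
        htel p hp u w hxi hxij a3 (cadj _ _ hpc c1) (cadj _ _ hpc c3),
        htel p hp x v hx hxj a2 (cadj _ _ hpc c0) (cadj _ _ hpc c2),
        htel p hp v w hxj hxij a4 (cadj _ _ hpc c2) (cadj _ _ hpc c3)]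
      ring
    · have hno : ∀ p, (∀ k, x k ≤ p k ∧ p k ≤ x k + 1) → p ∉ A :=
        fun p hpc hp => hex ⟨p, hp, hpc⟩
      rw [hzero _ _ (hno x c0) (hno u c1), hzero _ _ (hno u c1) (hno w c3),
        hzero _ _ (hno x c0) (hno v c2), hzero _ _ (hno v c2) (hno w c3)])
  have hg' : ∀ x y, x ∈ percBox d n → y ∈ percBox d n → percAdj x y → g y = g x + φ x y := by
    intro x y hx hy hxy
    obtain ⟨i, rfl | rfl⟩ := percAdj_iff.1 hxy
    · exact hg i x hx hy
    · have := hg i y hy hx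
      rw [hanti, this]
      ring
  have hAC : ∀ x ∈ C, x ∉ A := fun x hx h => hDC x (hAD x h) hx
  have hgD : ∀ x ∈ D, g x = g z := by
    intro x hx
    induction hx with
    | refl => rfl
    | tail _ h ih =>
      rw [hg' _ _ h.1.1 h.2.1.1 h.2.2, ih]
      simp [hφ, h.1.2, h.2.1.2]
  have hgC : ∀ x ∈ C, ∀ y, Relation.ReflTransGen (percStep d n ω) x y → y ∈ C ∧ g y = g x := by
    intro x hx y hxy
    induction hxy with
    | refl => exact ⟨hx, rfl⟩
    | tail _ h ih =>
      have hm := hC.2.2.2 _ ih.1 _ h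
      refine ⟨hm, ?_⟩
      rw [hg' _ _ h.1 h.2.1 h.2.2.2.2, ih.2, hzero _ _ (hAC _ ih.1) (hAC _ hm), add_zero]
  have haA : a ∈ A := ⟨ha, Relation.ReflTransGen.refl⟩
  obtain ⟨haD, a', ha', haa'⟩ := ha
  have hb' := hb
  obtain ⟨hbD, b', hb', hbb'⟩ := hb'
  have e1 := hg' a a' (outComp_mem hz haD).1 (hC.2.1 _ ha').1 haa'
  have e2 := hg' b b' (outComp_mem hz hbD).1 (hC.2.1 _ hb').1 hbb'
  have e3 := (hgC a' ha' b' (hC.2.2.1 a' ha' b' hb')).2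
  have e4 := hgD a haD
  have e5 := hgD b hbD
  have e6 : φ a a' = -1 := by simp [hφ, hDC a haD, haA, ha']
  have e7 : φ b b' = -1 := by omega
  by_contra hcon
  have hbA : b ∉ A := fun h => hcon h.2
  rw [hzero b b' hbA (hAC b' hb')] at e7
  omega

theorem update_mem_percBox {x : Site d} (hx : x ∈ percBox d n) (i : Fin d) {t : ℤ}
    (ht : 1 ≤ t ∧ t ≤ n) : Function.update x i t ∈ percBox d n := by
  intro j
  by_cases hj : j = i
  · subst hj; simpa using ht
  · simpa [hj] using hx j

theorem percAdj_update (x : Site d) (i : Fin d) (t : ℤ) :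
    percAdj (Function.update x i t) (Function.update x i (t + 1)) := by
  refine percAdj_iff.2 ⟨i, Or.inl ?_⟩
  ext j
  by_cases hj : j = i
  · subst hj; simp
  · simp [hj]

theorem line_const {χ : Site d → Prop} {x : Site d} {i : Fin d}
    (h : ∀ t : ℤ, 1 ≤ t → t + 1 ≤ n →
      (χ (Function.update x i t) ↔ χ (Function.update x i (t + 1))))
    {t t' : ℤ} (ht : 1 ≤ t ∧ t ≤ n) (ht' : 1 ≤ t' ∧ t' ≤ n) :
    χ (Function.update x i t) ↔ χ (Function.update x i t') := by
  have H : ∀ t : ℤ, 1 ≤ t → t ≤ n → (χ (Function.update x i 1) ↔ χ (Function.update x i t)) := by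
    intro t ht
    induction t, ht using Int.leInduction with
    | base => exact fun _ => Iff.rfl
    | succ t ht ih => exact fun htn => (ih (by omega)).trans (h t ht htn)
  exact (H t ht.1 ht.2).symm.trans (H t' ht'.1 ht'.2)

/-- The complement in the box of a product of proper subsets is connected. -/
theorem box_sdiff_pi_connected (hd : 2 ≤ d) (P : Fin d → Set ℤ)
    (hP : ∀ i, ∃ c : ℤ, (1 ≤ c ∧ c ≤ n) ∧ c ∉ P i) (χ : Site d → Prop)
    (h : ∀ x y, x ∈ percBox d n → y ∈ percBox d n → percAdj x y → (∃ i, x i ∉ P i) →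
      (∃ i, y i ∉ P i) → (χ x ↔ χ y))
    {x y : Site d} (hx : x ∈ percBox d n) (hy : y ∈ percBox d n) (hxP : ∃ i, x i ∉ P i)
    (hyP : ∃ i, y i ∉ P i) : χ x ↔ χ y := by
  choose c hc hcP using hP
  have hcB : c ∈ percBox d n := hc
  have seg : ∀ w ∈ percBox d n, ∀ j a, j ≠ a → w j ∉ P j → ∀ t : ℤ, 1 ≤ t ∧ t ≤ n →
      (χ w ↔ χ (Function.update w a t)) := by
    intro w hw j a hja hwj t ht
    have hout : ∀ s, ∃ i, Function.update w a s i ∉ P i := fun s => ⟨j, by simpa [hja] using hwj⟩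
    have := line_const (n := n) (χ := χ) (x := w) (i := a) (fun s hs hs' =>
      h _ _ (update_mem_percBox hw a (by omega)) (update_mem_percBox hw a (by omega))
        (percAdj_update _ _ _) (hout _) (hout _)) (hw a) ht
    rwa [Function.update_eq_self] at this
  suffices H : ∀ x ∈ percBox d n, (∃ i, x i ∉ P i) → (χ x ↔ χ c) from
    (H x hx hxP).trans (H y hy hyP).symm
  rintro x hx ⟨i, hi⟩
  have key : ∀ S : Finset (Fin d), i ∉ S →
      (fun j => if j ∈ S then c j else x j) ∈ percBox d n ∧
      (χ x ↔ χ (fun j => if j ∈ S then c j else x j)) := by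
    intro S
    induction S using Finset.induction_on with
    | empty => intro _; simpa using hx
    | insert a S haS ih =>
      intro hiS
      rw [Finset.mem_insert, not_or] at hiS
      obtain ⟨h1, h2⟩ := ih hiS.2
      have e : (fun j => if j ∈ insert a S then c j else x j)
          = Function.update (fun j => if j ∈ S then c j else x j) a (c a) := by
        ext j
        by_cases hj : j = a
        · subst hj; simp
        · simp [hj]
      rw [e]
      exact ⟨update_mem_percBox h1 a (hc a),
        h2.trans (seg _ h1 i a hiS.1 (by simpa [hiS.2] using hi) _ (hc a))⟩
  obtain ⟨k1, k2⟩ := key (Finset.univ.erase i) (by simp)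
  refine k2.trans ?_
  obtain ⟨j, hj⟩ : ∃ j : Fin d, j ≠ i := by
    have : Nontrivial (Fin d) := Fin.nontrivial_iff_two_le.2 hd
    exact exists_ne i
  rw [seg _ k1 j i hj (by simpa [hj] using hcP j) (c i) (hc i)]
  have e : Function.update (fun j => if j ∈ Finset.univ.erase i then c j else x j) i (c i) = c := by
    ext k
    by_cases hk : k = i
    · subst hk; simp
    · simp [hk]
  rw [e]

theorem coordProj_ncard_le {A : Set (Site d)} (hA : A ⊆ percBox d n) (i : Fin d) :
    (coordProj A i).ncard ≤ A.ncard :=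
  Set.ncard_image_le ((percBox_finite d n).subset hA)

theorem ncard_Icc_one (n : ℕ) : (Set.Icc (1 : ℤ) n).ncard = n := by
  rw [← Finset.coe_Icc, Set.ncard_coe_finset, Int.card_Icc]
  omega

theorem exists_notMem_coordProj {A : Set (Site d)} (hA : A ⊆ percBox d n) (hc : A.ncard < n)
    (i : Fin d) : ∃ c : ℤ, (1 ≤ c ∧ c ≤ n) ∧ c ∉ coordProj A i := by
  by_contra! hcon
  have h1 : Set.Icc (1 : ℤ) n ⊆ coordProj A i := fun t ht => hcon t ht
  have h2 := Set.ncard_le_ncard h1 (((percBox_finite d n).subset hA).image _)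
  rw [ncard_Icc_one] at h2
  have := coordProj_ncard_le hA i
  omega

/-- If the boundary of a complementary component is small, then either the component or its
complement lies in the product of the projections of that boundary. -/
theorem outComp_dichotomy (hd : 2 ≤ d) (hz : z ∈ percBox d n ∧ z ∉ C)
    (hc : (outBdry d n C z).ncard < n) :
    (∀ x ∈ outComp d n C z, ∀ i, x i ∈ coordProj (outBdry d n C z) i) ∨
    (∀ x ∈ percBox d n, x ∉ outComp d n C z → ∀ i, x i ∈ coordProj (outBdry d n C z) i) := by
  have hsub := outBdry_subset_box (n := n) hz
  have hin : ∀ x ∈ outBdry d n C z, ∀ i, x i ∈ coordProj (outBdry d n C z) i :=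
    fun x hx i => ⟨x, hx, rfl⟩
  by_contra! hcon
  obtain ⟨⟨x, hx, hxP⟩, y, hy, hyD, hyP⟩ := hcon
  have := box_sdiff_pi_connected hd _ (exists_notMem_coordProj hsub hc)
    (fun w => w ∈ outComp d n C z) (by
      rintro u v hu hv huv ⟨i, hi⟩ ⟨j, hj⟩
      constructor
      · intro h
        by_contra hvD
        exact hi (hin u ⟨h, v, mem_of_adj_outComp hz h hv huv hvD, huv⟩ i)
      · intro h
        by_contra huD
        exact hj (hin v ⟨h, u, mem_of_adj_outComp hz h hu (percAdj_symm huv) huD,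
          percAdj_symm huv⟩ j))
    (outComp_mem hz hx).1 hy hxP hyP
  exact hyD (this.1 hx)

theorem lineHull_subset_box (e : Fin d) (v : Site d) : lineHull d n ω e v ⊆ percBox d n := by
  rintro x ⟨y, hy, _, _, hyx⟩
  induction hyx with
  | refl => exact hy
  | tail _ h _ => exact h.2.1

theorem outBdry_subset_lineHull (hC : IsCluster d n ω C) (hz : z ∈ percBox d n ∧ z ∉ C)
    {e : Fin d} {v y : Site d} (hy : y ∈ outBdry d n C z) (hyv : ∀ j, j ≠ e → y j = v j) :
    outBdry d n C z ⊆ lineHull d n ω e v := fun _ hx =>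
  ⟨y, outBdry_subset_box hz hy, outBdry_closed hC hz hy, hyv, outBdry_connected hC hz hy hx⟩

theorem outBdry_ncard_lt (hC : IsCluster d n ω C) (hz : z ∈ percBox d n ∧ z ∉ C) {e : Fin d}
    {s : ℕ} (H : ∀ v ∈ percBox d n, (lineHull d n ω e v).ncard < s) :
    (outBdry d n C z).ncard < s := by
  rcases (outBdry d n C z).eq_empty_or_nonempty with h | ⟨y, hy⟩
  · rw [h, Set.ncard_empty]
    exact (Nat.zero_le _).trans_lt (H z hz.1)
  · exact (Set.ncard_le_ncard (outBdry_subset_lineHull hC hz hy fun _ _ => rfl)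
      ((percBox_finite d n).subset (lineHull_subset_box e y))).trans_lt
      (H y (outBdry_subset_box hz hy))

theorem outComp_line_iff (hz : z ∈ percBox d n ∧ z ∉ C) {v : Site d} (hv : v ∈ percBox d n)
    (i : Fin d) (hno : ∀ t : ℤ, 1 ≤ t ∧ t ≤ n → Function.update v i t ∉ outBdry d n C z)
    {t t' : ℤ} (ht : 1 ≤ t ∧ t ≤ n) (ht' : 1 ≤ t' ∧ t' ≤ n) :
    Function.update v i t ∈ outComp d n C z ↔ Function.update v i t' ∈ outComp d n C z := by
  refine line_const (χ := fun w => w ∈ outComp d n C z) (fun r hr hr' => ?_) ht ht'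
  have b1 := update_mem_percBox hv i (t := r) (by omega)
  have b2 := update_mem_percBox hv i (t := r + 1) (by omega)
  have hadj := percAdj_update v i r
  constructor
  · intro h
    by_contra hD
    exact hno r (by omega) ⟨h, _, mem_of_adj_outComp hz h b2 hadj hD, hadj⟩
  · intro h
    by_contra hD
    exact hno (r + 1) (by omega)
      ⟨h, _, mem_of_adj_outComp hz h b1 (percAdj_symm hadj) hD, percAdj_symm hadj⟩

theorem percStep_symm {x y : Site d} (h : percStep d n ω x y) : percStep d n ω y x :=
  ⟨h.2.1, h.1, h.2.2.2.1, h.2.2.1, percAdj_symm h.2.2.2.2⟩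

theorem isCluster_of_open {x : Site d} (hx : x ∈ percBox d n) (hω : ω x = true) :
    IsCluster d n ω {y | Relation.ReflTransGen (percStep d n ω) x y} := by
  have : Std.Symm (percStep d n ω) := ⟨fun _ _ h => percStep_symm h⟩
  refine ⟨⟨x, Relation.ReflTransGen.refl⟩, ?_, ?_, fun y hy w hyw => hy.tail hyw⟩
  · intro y hy
    induction hy with
    | refl => exact ⟨hx, hω⟩
    | tail _ h _ => exact ⟨h.2.1, h.2.2.2.1⟩
  · intro y hy w hw
    exact (Relation.ReflTransGen.stdSymm.symm _ _ hy).trans hw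

theorem IsCluster.mem_of_reflTransGen (hC : IsCluster d n ω C) {x y : Site d} (hx : x ∈ C)
    (h : Relation.ReflTransGen (percStep d n ω) x y) : y ∈ C := by
  induction h with
  | refl => exact hx
  | tail _ h ih => exact hC.2.2.2 _ ih _ h

theorem IsCluster.eq_of_mem {C' : Set (Site d)} (hC : IsCluster d n ω C)
    (hC' : IsCluster d n ω C') {x : Site d} (hx : x ∈ C) (hx' : x ∈ C') : C = C' :=
  Set.Subset.antisymm (fun y hy => hC'.mem_of_reflTransGen hx' (hC.2.2.1 x hx y hy))
    (fun y hy => hC.mem_of_reflTransGen hx (hC'.2.2.1 x hx' y hy))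

theorem abs_sub_le_one_of_percAdj {x y : Site d} (h : percAdj x y) (i : Fin d) :
    |x i - y i| ≤ 1 := by
  obtain ⟨j, rfl | rfl⟩ := percAdj_iff.1 h <;>
  · simp only [Pi.add_apply, Pi.single_apply, abs_le]
    split_ifs <;> omega

/-- Open paths take all intermediate coordinate values. -/
theorem exists_coord_eq_of_reflTransGen {x y : Site d}
    (h : Relation.ReflTransGen (percStep d n ω) x y) (i : Fin d) :
    ∀ t ∈ Set.uIcc (x i) (y i), ∃ w, Relation.ReflTransGen (percStep d n ω) x w ∧ w i = t := by
  induction h with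
  | refl =>
    intro t ht
    refine ⟨x, Relation.ReflTransGen.refl, ?_⟩
    rw [Set.uIcc_self, Set.mem_singleton_iff] at ht
    exact ht.symm
  | @tail b c hb hbc ih =>
    intro t ht
    by_cases htb : t ∈ Set.uIcc (x i) (b i)
    · exact ih t htb
    · refine ⟨c, hb.tail hbc, ?_⟩
      have := abs_sub_le_one_of_percAdj hbc.2.2.2.2 i
      rw [abs_le] at this
      rw [Set.mem_uIcc] at ht htb
      omega

/-- If all closed hulls of parallel lines are small, then there is a cluster that meets all lines,
misses few points of each of the parallel lines, and is the only cluster of large diameter. -/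
theorem exists_giant_cluster (hd : 2 ≤ d) (hn : 1 ≤ n) (e : Fin d) {s : ℕ} (hsn : s ≤ n)
    (H : ∀ v ∈ percBox d n, (lineHull d n ω e v).ncard < s) :
    ∃ C, IsCluster d n ω C ∧
      (∀ v ∈ percBox d n, ∀ i, ∃ t : ℤ, (1 ≤ t ∧ t ≤ n) ∧ Function.update v i t ∈ C) ∧
      (∀ v ∈ percBox d n,
        {t : ℤ | (1 ≤ t ∧ t ≤ n) ∧ Function.update v e t ∉ C}.ncard < s) ∧
      (∀ C', IsCluster d n ω C' → C' ≠ C → ∀ x ∈ C', ∀ y ∈ C', linfD x y + 1 < s) := by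
  have hn1 : (1 : ℤ) ≤ n := by exact_mod_cast hn
  obtain ⟨v, hv⟩ : ∃ v, v ∈ percBox d n := ⟨fun _ => 1, fun _ => ⟨le_rfl, hn1⟩⟩
  obtain ⟨t, ht, htv⟩ := exists_notMem_coordProj (lineHull_subset_box e v)
    ((H v hv).trans_le hsn) e
  have hxB := update_mem_percBox hv e ht
  have hxo : ω (Function.update v e t) = true := by
    by_contra h
    refine htv ⟨_, ⟨_, hxB, by simpa using h, ?_, Relation.ReflTransGen.refl⟩, by simp⟩
    intro j hj
    simp [hj]
  obtain ⟨C, hC, hxC⟩ : ∃ C, IsCluster d n ω C ∧ Function.update v e t ∈ C :=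
    ⟨_, isCluster_of_open hxB hxo, Relation.ReflTransGen.refl⟩
  have hex : ∀ z, z ∈ percBox d n ∧ z ∉ C → ∀ i, ∃ c : ℤ, (1 ≤ c ∧ c ≤ n) ∧
      c ∉ coordProj (outBdry d n C z) i := fun z hz =>
    exists_notMem_coordProj (outBdry_subset_box hz) ((outBdry_ncard_lt hC hz H).trans_le hsn)
  have hD : ∀ z, z ∈ percBox d n ∧ z ∉ C → ∀ x ∈ outComp d n C z, ∀ i,
      x i ∈ coordProj (outBdry d n C z) i := by
    intro z hz
    rcases outComp_dichotomy hd hz ((outBdry_ncard_lt hC hz H).trans_le hsn) with h | h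
    · exact h
    exfalso
    have hxD : Function.update v e t ∉ outComp d n C z := fun h => (outComp_mem hz h).2 hxC
    by_cases hline : ∀ r : ℤ, 1 ≤ r ∧ r ≤ n → Function.update v e r ∉ outBdry d n C z
    · obtain ⟨c, hc, hcP⟩ := hex z hz e
      have := h _ (update_mem_percBox hv e hc)
        (fun hcD => hxD ((outComp_line_iff hz hv e hline hc ht).1 hcD)) e
      exact hcP (by simpa using this)
    · push Not at hline
      obtain ⟨r, _, hrb⟩ := hline
      obtain ⟨w, hw, hwe⟩ := h _ hxB hxD e
      exact htv ⟨w, outBdry_subset_lineHull hC hz hrb (fun j hj => by simp [hj]) hw,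
        by simpa using hwe⟩
  have hhit : ∀ v ∈ percBox d n, ∀ i, ∃ t : ℤ, (1 ≤ t ∧ t ≤ n) ∧ Function.update v i t ∈ C := by
    intro v hv i
    by_contra! hcon
    have h1 : (1 : ℤ) ≤ 1 ∧ (1 : ℤ) ≤ n := ⟨le_rfl, hn1⟩
    have hz : Function.update v i 1 ∈ percBox d n ∧ Function.update v i 1 ∉ C :=
      ⟨update_mem_percBox hv i h1, hcon 1 h1⟩
    obtain ⟨c, hc, hcP⟩ := hex _ hz i
    have hline : ∀ r : ℤ, 1 ≤ r ∧ r ≤ n →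
        Function.update v i r ∈ outComp d n C (Function.update v i 1) := by
      intro r hr
      refine (line_const (n := n)
        (χ := fun w => w ∈ outComp d n C (Function.update v i 1)) (fun a ha ha' => ?_) h1 hr).1
        outComp_self
      have b1 := update_mem_percBox hv i (t := a) (by omega)
      have b2 := update_mem_percBox hv i (t := a + 1) (by omega)
      have hadj := percAdj_update v i a
      constructor
      · intro h
        by_contra hn
        exact hcon _ (by omega) (mem_of_adj_outComp hz h b2 hadj hn)
      · intro h
        by_contra hn
        exact hcon _ (by omega) (mem_of_adj_outComp hz h b1 (percAdj_symm hadj) hn)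
    have := hD _ hz _ (hline c hc) i
    exact hcP (by simpa using this)
  refine ⟨C, hC, hhit, ?_, ?_⟩
  · intro v hv
    have hfin := (percBox_finite d n).subset (lineHull_subset_box (ω := ω) e v)
    refine lt_of_le_of_lt (Set.ncard_le_ncard (t := coordProj (lineHull d n ω e v) e) ?_
      (hfin.image _)) ((coordProj_ncard_le (lineHull_subset_box e v) e).trans_lt (H v hv))
    rintro r ⟨hr, hrC⟩
    have hz : Function.update v e r ∈ percBox d n ∧ Function.update v e r ∉ C :=
      ⟨update_mem_percBox hv e hr, hrC⟩
    obtain ⟨r', hr', hrC'⟩ := hhit v hv e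
    have hb : ∃ a : ℤ, (1 ≤ a ∧ a ≤ n) ∧
        Function.update v e a ∈ outBdry d n C (Function.update v e r) := by
      by_contra! hline
      exact (outComp_mem hz ((outComp_line_iff hz hv e hline hr hr').1 outComp_self)).2 hrC'
    obtain ⟨a, _, ha⟩ := hb
    obtain ⟨w, hw, hwe⟩ := hD _ hz _ outComp_self e
    exact ⟨w, outBdry_subset_lineHull hC hz ha (fun j hj => by simp [hj]) hw, by simpa using hwe⟩
  · intro C' hC' hne x hx y hy
    have hdisj : ∀ w ∈ C', w ∉ C := fun w hw hwC => hne (hC'.eq_of_mem hC hw hwC)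
    have hz : x ∈ percBox d n ∧ x ∉ C := ⟨(hC'.2.1 x hx).1, hdisj x hx⟩
    have hsub : ∀ w, Relation.ReflTransGen (percStep d n ω) x w → w ∈ outComp d n C x := by
      intro w hw
      induction hw with
      | refl => exact outComp_self
      | @tail b c hb hbc ih =>
        have hbC' := hC'.mem_of_reflTransGen hx hb
        exact ih.tail ⟨⟨hbc.1, hdisj _ hbC'⟩,
          ⟨hbc.2.1, hdisj _ (hC'.2.2.2 _ hbC' _ hbc)⟩, hbc.2.2.2.2⟩
    have hi : ∀ i, (x i - y i).natAbs + 1 < s := by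
      intro i
      have h1 : Set.uIcc (x i) (y i) ⊆ coordProj (outBdry d n C x) i := by
        intro r hr
        obtain ⟨w, hw, rfl⟩ := exists_coord_eq_of_reflTransGen (hC'.2.2.1 x hx y hy) i r hr
        exact hD x hz w (hsub w hw) i
      have h2 := Set.ncard_le_ncard h1
        (((percBox_finite d n).subset (outBdry_subset_box hz)).image _)
      rw [← Finset.coe_uIcc, Set.ncard_coe_finset, Int.card_uIcc] at h2
      have h3 := coordProj_ncard_le (outBdry_subset_box (n := n) hz) i
      have h4 := outBdry_ncard_lt hC hz H
      omega
    have h5 := hi e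
    have h6 : linfD x y ≤ s - 2 := Finset.sup_le fun i _ => by
      have := hi i
      omega
    omega

theorem percBox_eq_piFinset (d n : ℕ) :
    percBox d n = ↑(Fintype.piFinset fun _ : Fin d => Finset.Icc (1 : ℤ) n) := by
  ext x
  rw [Finset.mem_coe, Fintype.mem_piFinset]
  simp only [Finset.mem_Icc]
  rfl

theorem percBox_ncard (d n : ℕ) : (percBox d n).ncard = n ^ d := by
  rw [percBox_eq_piFinset, Set.ncard_coe_finset]
  simp

open Classical in
/-- A set missing at most `m` points of each line in direction `e` misses at most
`m * n ^ (d - 1)` points of the box. -/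
theorem ncard_sdiff_le_of_lines (e : Fin d) {m : ℕ}
    (h : ∀ v ∈ percBox d n, {t : ℤ | (1 ≤ t ∧ t ≤ n) ∧ Function.update v e t ∉ C}.ncard ≤ m) :
    (percBox d n \ C).ncard ≤ m * n ^ (d - 1) := by
  rcases Nat.eq_zero_or_pos n with rfl | hn
  · have : percBox d 0 = ∅ := by
      ext x
      rw [Set.mem_empty_iff_false, iff_false]
      intro hx
      have := hx e
      omega
    simp [this]
  set B := Fintype.piFinset fun _ : Fin d => Finset.Icc (1 : ℤ) n with hB
  have hmem : ∀ x, x ∈ B ↔ x ∈ percBox d n := fun x => by simp [hB, percBox]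
  have e1 : percBox d n \ C = ↑(B.filter fun x => x ∉ C) := by
    ext x
    simp [hmem]
  rw [e1, Set.ncard_coe_finset]
  set T := Fintype.piFinset fun i : Fin d => if i = e then {1} else Finset.Icc (1 : ℤ) n with hT
  have hTc : T.card = n ^ (d - 1) := by
    rw [hT, Fintype.card_piFinset, ← Finset.mul_prod_erase _ _ (Finset.mem_univ e)]
    rw [Finset.prod_congr rfl (g := fun _ => n)
      (fun i hi => by simp [(Finset.mem_erase.1 hi).1])]
    simp
  rw [← hTc]
  have hTB : ∀ b ∈ T, b ∈ percBox d n := by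
    intro b hb i
    rw [hT, Fintype.mem_piFinset] at hb
    have := hb i
    split_ifs at this
    · rw [Finset.mem_singleton] at this; omega
    · simpa using this
  refine Finset.card_le_mul_card_image_of_maps_to (f := fun x => Function.update x e 1) ?_ m ?_
  · intro a ha
    have ha' := (hmem a).1 (Finset.mem_filter.1 ha).1
    rw [hT, Fintype.mem_piFinset]
    intro i
    by_cases hi : i = e
    · subst hi; simp
    · simpa [hi] using ha' i
  · intro b hb
    have hfin : {t : ℤ | (1 ≤ t ∧ t ≤ n) ∧ Function.update b e t ∉ C}.Finite :=
      (Set.finite_Icc (1 : ℤ) n).subset fun t ht => ht.1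
    have hrec : ∀ a ∈ (B.filter fun x => x ∉ C).filter (fun x => Function.update x e 1 = b),
        Function.update b e (a e) = a := by
      intro a ha
      rw [← (Finset.mem_filter.1 ha).2]
      simp
    rw [← Set.ncard_coe_finset]
    refine (Set.ncard_le_ncard_of_injOn (fun a : Site d => a e) ?_ ?_ hfin).trans (h b (hTB b hb))
    · intro a ha
      have hr := hrec a ha
      rw [Finset.mem_coe, Finset.mem_filter, Finset.mem_filter, hmem] at ha
      exact ⟨ha.1.1 e, by rw [hr]; exact ha.1.2⟩
    · intro a ha a' ha' haa'
      rw [← hrec a ha, ← hrec a' ha']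
      simp only at haa'
      rw [haa']

theorem mem_events_of_lineHull_small (hd : 2 ≤ d) (hn : 1 ≤ n) (e : Fin d) {s : ℕ} (hsn : s ≤ n)
    {κ : ℝ} (hs : s ≤ n / 10 + 1) (hκ : (s : ℝ) - 1 ≤ (1 - κ) * n)
    (H : ∀ v ∈ percBox d n, (lineHull d n ω e v).ncard < s) :
    ω ∈ eventA d n ∩ eventB d n ∩ eventC d n κ := by
  obtain ⟨C, hC, hhit, hcount, hsmall⟩ := exists_giant_cluster hd hn e hsn H
  have hn1 : (1 : ℤ) ≤ n := by exact_mod_cast hn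
  have hbig : ∀ C', IsCluster d n ω C' → bigDiam d n C' → C' = C := by
    rintro C' hC' ⟨x, hx, y, hy, hxy⟩
    by_contra hne
    have := hsmall C' hC' hne x hx y hy
    omega
  refine ⟨⟨fun C₁ C₂ h₁ h₂ b₁ b₂ => (hbig _ h₁ b₁).trans (hbig _ h₂ b₂).symm, C, hC, ?_⟩, C, hC, ?_⟩
  · intro j
    obtain ⟨i, hi⟩ : ∃ i : Fin d, i ≠ j := by
      have : Nontrivial (Fin d) := Fin.nontrivial_iff_two_le.2 hd
      exact exists_ne j
    have key : ∀ a : ℤ, 1 ≤ a ∧ a ≤ n → ∃ x ∈ C, x j = a := by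
      intro a ha
      obtain ⟨t, _, ht⟩ := hhit (fun _ => a) (fun _ => ha) i
      exact ⟨_, ht, by simp [hi.symm]⟩
    exact ⟨key 1 ⟨le_rfl, hn1⟩, key n ⟨hn1, le_rfl⟩⟩
  · have h1 := ncard_sdiff_le_of_lines (C := C) e (m := s - 1)
      (fun v hv => by have := hcount v hv; omega)
    have hCB : C ⊆ percBox d n := fun x hx => (hC.2.1 x hx).1
    have h2 := Set.ncard_sdiff_add_ncard_of_subset hCB (percBox_finite d n)
    rw [percBox_ncard] at h2
    have hs1 : 1 ≤ s := (Nat.zero_le _).trans_lt (H (fun _ => 1) fun _ => ⟨le_rfl, hn1⟩)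
    have h3 : (n : ℝ) ^ d = n ^ (d - 1) * n := by
      rw [← pow_succ, Nat.sub_add_cancel (by omega)]
    have h4 : ((percBox d n \ C).ncard : ℝ) ≤ ((s : ℝ) - 1) * n ^ (d - 1) := by
      have : ((percBox d n \ C).ncard : ℝ) ≤ (((s - 1) * n ^ (d - 1) : ℕ) : ℝ) := by
        exact_mod_cast h1
      simpa [Nat.cast_sub hs1] using this
    have h5 : ((percBox d n \ C).ncard : ℝ) + C.ncard = n ^ d := by exact_mod_cast h2
    have h6 := mul_le_mul_of_nonneg_right hκ (pow_nonneg (Nat.cast_nonneg (α := ℝ) n) (d - 1))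
    rw [h3] at h5 ⊢
    nlinarith

end Geometry

section Walks

/-- In a connected finite set there is a walk of `2 * r` steps visiting at least `r + 1` points,
or all points. -/
theorem exists_covering_walk {α : Type*} [DecidableEq α] {R : α → α → Prop} (hrefl : ∀ a, R a a)
    (hsymm : ∀ a b, R a b → R b a) {T : Finset α} {v : α} (hv : v ∈ T)
    (hT : ∀ x ∈ T, Relation.ReflTransGen (fun a b => b ∈ T ∧ R a b) v x) (r : ℕ) :
    ∃ l : List α, l.IsChain R ∧ l.length = 2 * r + 1 ∧ l.head? = some v ∧ l.toFinset ⊆ T ∧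
      min (r + 1) T.card ≤ l.toFinset.card := by
  induction r with
  | zero => exact ⟨[v], by simp, rfl, rfl, by simpa using hv, by simp⟩
  | succ r ih =>
    obtain ⟨l, hl, hlen, hhead, hsub, hcard⟩ := ih
    have hvl : v ∈ l := List.mem_of_head? hhead
    by_cases hall : T ⊆ l.toFinset
    · obtain ⟨l', rfl⟩ : ∃ l', l = v :: l' := by
        cases l with
        | nil => simp at hhead
        | cons a l' => exact ⟨l', by simpa using hhead⟩
      refine ⟨v :: v :: v :: l', ?_, by simp at hlen ⊢; omega, rfl, by simpa using hsub, ?_⟩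
      · exact List.isChain_cons_cons.2 ⟨hrefl v, List.isChain_cons_cons.2 ⟨hrefl v, hl⟩⟩
      · refine (min_le_right _ _).trans (Finset.card_le_card ?_)
        simpa using hall
    · obtain ⟨x, hxT, hxl⟩ := Finset.not_subset.1 hall
      have hcross : ∃ u ∈ l, ∃ w ∈ T, w ∉ l ∧ R u w := by
        by_contra! hno
        have : ∀ y, Relation.ReflTransGen (fun a b => b ∈ T ∧ R a b) v y → y ∈ l := by
          intro y hy
          induction hy with
          | refl => exact hvl
          | @tail b c _ hbc ih =>
            by_contra hc
            exact hno b ih c hbc.1 hc hbc.2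
        exact hxl (List.mem_toFinset.2 (this x (hT x hxT)))
      obtain ⟨u, hu, w, hwT, hwl, huw⟩ := hcross
      obtain ⟨l₁, l₂, rfl⟩ := List.append_of_mem hu
      have hfin : (l₁ ++ u :: w :: u :: l₂).toFinset = insert w (l₁ ++ u :: l₂).toFinset := by
        ext y
        simp only [List.mem_toFinset, List.mem_append, List.mem_cons, Finset.mem_insert]
        tauto
      refine ⟨l₁ ++ u :: w :: u :: l₂, ?_, ?_, ?_, ?_, ?_⟩
      · rw [List.isChain_split] at hl ⊢
        exact ⟨hl.1, List.isChain_cons_cons.2 ⟨huw, List.isChain_cons_cons.2 ⟨hsymm _ _ huw, hl.2⟩⟩⟩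
      · simp at hlen ⊢
        omega
      · cases l₁ <;> simpa using hhead
      · rw [hfin]
        exact Finset.insert_subset hwT hsub
      · rw [hfin, Finset.card_insert_of_notMem fun h => hwl (List.mem_toFinset.1 h)]
        omega

variable {d : ℕ}

/-- The sites at `ℓ^∞` distance at most one from `v`. -/
def starNbrs (v : Site d) : Finset (Site d) :=
  Fintype.piFinset fun i => Finset.Icc (v i - 1) (v i + 1)

open Classical in
/-- The `ℓ^∞` walks with `m` steps started at `v`. -/
def starWalks : ℕ → Site d → Finset (List (Site d))
  | 0, v => {[v]}
  | m + 1, v => (starNbrs v).biUnion fun u => (starWalks m u).image (List.cons v)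

theorem starNbrs_card (v : Site d) : (starNbrs v).card = 3 ^ d := by
  rw [starNbrs, Fintype.card_piFinset, Finset.prod_congr rfl (g := fun _ => 3)]
  · simp
  · intro i _
    rw [Int.card_Icc]
    omega

theorem starWalks_card_le (m : ℕ) (v : Site d) : (starWalks m v).card ≤ (3 ^ d) ^ m := by
  induction m generalizing v with
  | zero => simp [starWalks]
  | succ m ih =>
    rw [starWalks, pow_succ', ← starNbrs_card v]
    exact Finset.card_biUnion_le_card_mul _ _ _ fun u _ => Finset.card_image_le.trans (by
      rw [starNbrs_card]
      exact ih u)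

theorem length_of_mem_starWalks {m : ℕ} {v : Site d} {l : List (Site d)}
    (h : l ∈ starWalks m v) : l.length = m + 1 := by
  induction m generalizing v l with
  | zero => simp only [starWalks, Finset.mem_singleton] at h; simp [h]
  | succ m ih =>
    simp only [starWalks, Finset.mem_biUnion, Finset.mem_image] at h
    obtain ⟨u, _, l', hl', rfl⟩ := h
    simp [ih hl']

theorem mem_starWalks {m : ℕ} {v : Site d} {l : List (Site d)} (h : l.IsChain starAdj)
    (hlen : l.length = m + 1) (hhead : l.head? = some v) : l ∈ starWalks m v := by
  induction m generalizing v l with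
  | zero =>
    obtain ⟨a, rfl⟩ := List.length_eq_one_iff.1 hlen
    simpa [starWalks] using hhead
  | succ m ih =>
    match l, hlen with
    | a :: b :: l', hlen =>
      obtain rfl : a = v := by simpa using hhead
      rw [List.isChain_cons_cons] at h
      simp only [starWalks, Finset.mem_biUnion, Finset.mem_image]
      refine ⟨b, ?_, b :: l', ih h.2 (by simpa using hlen) rfl, rfl⟩
      rw [starNbrs, Fintype.mem_piFinset]
      intro i
      have := h.1 i
      rw [abs_le] at this
      rw [Finset.mem_Icc]
      omega

variable {n : ℕ} {ω : PConfig d}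

theorem closed_of_mem_lineHull {e : Fin d} {v x : Site d} (hx : x ∈ lineHull d n ω e v) :
    ω x = false := by
  obtain ⟨y, _, hy, _, hyx⟩ := hx
  induction hyx with
  | refl => exact hy
  | tail _ h _ => exact h.2.2.2.1

theorem lineHull_union_line_connected (e : Fin d) {v : Site d} (hv : v ∈ percBox d n)
    {T : Set (Site d)} (hT : ∀ x, x ∈ T ↔
      x ∈ percBox d n ∧ (x ∈ lineHull d n ω e v ∨ ∀ j, j ≠ e → x j = v j)) {x : Site d}
    (hx : x ∈ T) : Relation.ReflTransGen (fun a b => b ∈ T ∧ starAdj a b) v x := by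
  have hline : ∀ y, y ∈ percBox d n → (∀ j, j ≠ e → y j = v j) →
      Relation.ReflTransGen (fun a b => b ∈ T ∧ starAdj a b) v y := by
    intro y hy hyv
    have hy' : Function.update v e (y e) = y := by
      ext j
      by_cases hj : j = e
      · subst hj; simp
      · simp [hj, hyv j hj]
    have hmem : ∀ t : ℤ, 1 ≤ t ∧ t ≤ n → Function.update v e t ∈ T := fun t ht =>
      (hT _).2 ⟨update_mem_percBox hv e ht, Or.inr fun j hj => by simp [hj]⟩
    have := line_const (n := n)
      (χ := fun w => Relation.ReflTransGen (fun a b => b ∈ T ∧ starAdj a b) v w) (x := v) (i := e)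
      (fun t ht ht' => by
        have hadj := percAdj_update v e t
        exact ⟨fun h => h.tail ⟨hmem _ (by omega), abs_sub_le_one_of_percAdj hadj⟩,
          fun h => h.tail ⟨hmem _ (by omega), abs_sub_le_one_of_percAdj (percAdj_symm hadj)⟩⟩)
      (hv e) (hy e)
    rw [Function.update_eq_self, hy'] at this
    exact this.1 Relation.ReflTransGen.refl
  obtain ⟨hxB, hx | hx⟩ := (hT x).1 hx
  · obtain ⟨y, hyB, hyc, hyv, hyx⟩ := hx
    clear hxB
    induction hyx with
    | refl => exact hline y hyB hyv
    | @tail b c hb hbc ih =>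
      have hbT : ∀ w, Relation.ReflTransGen (closedStep d n ω) y w → w ∈ percBox d n → w ∈ T :=
        fun w hw hwB => (hT w).2 ⟨hwB, Or.inl ⟨y, hyB, hyc, hyv, hw⟩⟩
      exact (ih (hbT b hb hbc.1)).tail ⟨hbT c (hb.tail hbc) hbc.2.1, hbc.2.2.2.2⟩
  · exact hline x hxB hx

open Classical in
theorem exists_walk_of_lineHull_large (e : Fin d) {v : Site d} (hv : v ∈ percBox d n) {s : ℕ}
    (hsn : s ≤ n) (hs : s ≤ (lineHull d n ω e v).ncard) :
    ∃ l ∈ starWalks (4 * n) v, ∃ A ∈ l.toFinset.powersetCard s, ∀ x ∈ A, ω x = false := by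
  set T : Finset (Site d) := (percBox_finite d n).toFinset.filter
    (fun x => x ∈ lineHull d n ω e v ∨ ∀ j, j ≠ e → x j = v j) with hTdef
  have hT : ∀ x, x ∈ T ↔
      x ∈ percBox d n ∧ (x ∈ lineHull d n ω e v ∨ ∀ j, j ≠ e → x j = v j) := by
    intro x
    simp [hTdef]
  have hvT : v ∈ T := (hT v).2 ⟨hv, Or.inr fun _ _ => rfl⟩
  obtain ⟨l, hl, hlen, hhead, hsub, hcard⟩ := exists_covering_walk (R := starAdj)
    (fun a i => by simp) (fun a b h i => by rw [abs_sub_comm]; exact h i) hvT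
    (fun x hx => lineHull_union_line_connected e hv (T := ↑T) (fun y => hT y) hx) (2 * n)
  refine ⟨l, mem_starWalks hl (by omega) hhead, ?_⟩
  have hle : s ≤ (l.toFinset.filter fun x => x ∈ lineHull d n ω e v).card := by
    by_cases hTn : T.card ≤ 2 * n + 1
    · have hlT : l.toFinset = T := Finset.eq_of_subset_of_card_le hsub (by omega)
      rw [hlT]
      refine hs.trans ?_
      rw [← Set.ncard_coe_finset]
      refine Set.ncard_le_ncard (fun x hx => ?_) (Finset.finite_toSet _)
      rw [Finset.mem_coe, Finset.mem_filter, hT]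
      exact ⟨⟨lineHull_subset_box e v hx, Or.inl hx⟩, hx⟩
    · have h1 := Finset.card_filter_add_card_filter_not (s := l.toFinset)
        (fun x => x ∈ lineHull d n ω e v)
      have h2 : (l.toFinset.filter fun x => ¬ x ∈ lineHull d n ω e v).card ≤ n := by
        have h3 : (Finset.Icc (1 : ℤ) n).card = n := by simp
        refine le_trans ?_ h3.le
        have hmem : ∀ x ∈ l.toFinset.filter fun x => ¬ x ∈ lineHull d n ω e v,
            x ∈ percBox d n ∧ ∀ j, j ≠ e → x j = v j := by
          intro x hx
          rw [Finset.mem_filter] at hx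
          have := (hT x).1 (hsub hx.1)
          exact ⟨this.1, this.2.resolve_left hx.2⟩
        refine Finset.card_le_card_of_injOn (fun x => x e)
          (fun x hx => Finset.mem_coe.2 (Finset.mem_Icc.2 ((hmem x hx).1 e))) ?_
        intro x hx y hy hxy
        ext j
        by_cases hj : j = e
        · subst hj; exact hxy
        · rw [(hmem x hx).2 j hj, (hmem y hy).2 j hj]
      omega
  obtain ⟨A, hA, hAc⟩ := Finset.exists_subset_card_eq hle
  refine ⟨A, Finset.mem_powersetCard.2 ⟨hA.trans (Finset.filter_subset _ _), hAc⟩, fun x hx => ?_⟩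
  exact closed_of_mem_lineHull (Finset.mem_filter.1 (hA hx)).2

open Classical in
theorem measure_lineHull_large_le {p : ℝ} {μ : Measure (PConfig d)}
    (hμ : IsBernoulliPerc d p μ) (e : Fin d) {v : Site d} (hv : v ∈ percBox d n) {s : ℕ}
    (hsn : s ≤ n) :
    μ {ω | s ≤ (lineHull d n ω e v).ncard} ≤
      ((3 ^ d) ^ (4 * n) * 2 ^ (4 * n + 1) : ℕ) * ENNReal.ofReal (1 - p) ^ s := by
  have hsub : {ω | s ≤ (lineHull d n ω e v).ncard} ⊆
      ⋃ l ∈ starWalks (4 * n) v, ⋃ A ∈ l.toFinset.powersetCard s,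
        {ω : PConfig d | ∀ x ∈ A, ω x = false} := by
    intro ω hω
    obtain ⟨l, hl, A, hA, h⟩ := exists_walk_of_lineHull_large e hv hsn hω
    exact Set.mem_biUnion hl (Set.mem_biUnion hA h)
  have hA : ∀ A : Finset (Site d), A.card = s →
      μ {ω : PConfig d | ∀ x ∈ A, ω x = false} = ENNReal.ofReal (1 - p) ^ s := by
    intro A hA
    rw [hμ.2 A fun _ => false]
    simp [hA]
  have hl : ∀ l ∈ starWalks (4 * n) v, μ (⋃ A ∈ l.toFinset.powersetCard s,
      {ω : PConfig d | ∀ x ∈ A, ω x = false}) ≤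
        (2 ^ (4 * n + 1) : ℕ) * ENNReal.ofReal (1 - p) ^ s := by
    intro l hl
    refine (measure_biUnion_finset_le _ _).trans ?_
    rw [Finset.sum_congr rfl fun A h => hA A (Finset.mem_powersetCard.1 h).2, Finset.sum_const,
      nsmul_eq_mul]
    gcongr
    rw [Finset.card_powersetCard]
    refine (Nat.choose_le_two_pow _ _).trans (Nat.pow_le_pow_right (by norm_num) ?_)
    exact (List.toFinset_card_le l).trans (length_of_mem_starWalks hl).le
  refine (measure_mono hsub).trans ((measure_biUnion_finset_le _ _).trans ?_)
  refine (Finset.sum_le_card_nsmul _ _ _ hl).trans ?_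
  rw [nsmul_eq_mul, Nat.cast_mul, mul_assoc]
  gcongr
  exact starWalks_card_le _ _

theorem measure_events_compl_le (hd : 2 ≤ d) (hn : 1 ≤ n) {p κ : ℝ} {μ : Measure (PConfig d)}
    (hμ : IsBernoulliPerc d p μ) {s : ℕ} (hsn : s ≤ n) (hs : s ≤ n / 10 + 1)
    (hκ : (s : ℝ) - 1 ≤ (1 - κ) * n) :
    μ (eventA d n ∩ eventB d n ∩ eventC d n κ)ᶜ ≤
      (n ^ d * ((3 ^ d) ^ (4 * n) * 2 ^ (4 * n + 1)) : ℕ) * ENNReal.ofReal (1 - p) ^ s := by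
  set e : Fin d := ⟨0, by omega⟩
  have hsub : (eventA d n ∩ eventB d n ∩ eventC d n κ)ᶜ ⊆
      ⋃ v ∈ (percBox_finite d n).toFinset, {ω | s ≤ (lineHull d n ω e v).ncard} := by
    intro ω hω
    by_contra hcon
    refine hω (mem_events_of_lineHull_small hd hn e hsn hs hκ fun v hv => ?_)
    by_contra! hle
    exact hcon (Set.mem_biUnion ((percBox_finite d n).mem_toFinset.2 hv) hle)
  refine (measure_mono hsub).trans ((measure_biUnion_finset_le _ _).trans ?_)
  refine (Finset.sum_le_card_nsmul _ _ _ fun v hv =>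
    measure_lineHull_large_le hμ e ((percBox_finite d n).mem_toFinset.1 hv) hsn).trans ?_
  rw [nsmul_eq_mul, ← mul_assoc, ← Nat.cast_mul,
    ← Set.ncard_eq_toFinset_card _ (percBox_finite d n), percBox_ncard]

theorem measure_events_ge_of_all_open (hd : 2 ≤ d) (hn : 1 ≤ n) {p κ : ℝ} (hκ : κ < 1)
    {μ : Measure (PConfig d)} (hμ : IsBernoulliPerc d p μ) :
    ENNReal.ofReal p ^ n ^ d ≤ μ (eventA d n ∩ eventB d n ∩ eventC d n κ) := by
  have h1 := hμ.2 (percBox_finite d n).toFinset fun _ => true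
  simp only [if_true, Finset.prod_const,
    ← Set.ncard_eq_toFinset_card _ (percBox_finite d n), percBox_ncard] at h1
  rw [← h1]
  refine measure_mono fun ω hω => ?_
  refine mem_events_of_lineHull_small hd hn ⟨0, by omega⟩ (s := 1) hn (by omega) ?_ ?_
  · have : 0 ≤ (1 - κ) * n := mul_nonneg (by linarith) (Nat.cast_nonneg n)
    simpa using this
  · intro v hv
    have : lineHull d n ω ⟨0, by omega⟩ v = ∅ := by
      rw [Set.eq_empty_iff_forall_notMem]
      intro x hx
      have h2 := closed_of_mem_lineHull hx
      have h3 := hω x ((percBox_finite d n).mem_toFinset.2 (lineHull_subset_box _ _ hx))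
      rw [h2] at h3
      exact absurd h3 (by simp)
    rw [this, Set.ncard_empty]
    exact one_pos

end Walks

/-- Lemma B.1: for `p < 1` large, `P(𝒜_n ∩ ℬ_n ∩ 𝒞_n(κ)) ≥ 1 - e^{-cn}`. -/
theorem stmt_14 {d : ℕ} (hd : 2 ≤ d) (κ : ℝ) (hκ0 : 0 < κ) (hκ1 : κ < 1) :
    ∃ p₀ : ℝ, p₀ < 1 ∧ ∀ p : ℝ, p₀ ≤ p → p < 1 →
      ∃ c : ℝ, 0 < c ∧
        ∀ μ : Measure (PConfig d), IsBernoulliPerc d p μ →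
          ∀ n : ℕ, 1 ≤ n →
            1 - ENNReal.ofReal (Real.exp (-c * n)) ≤
              μ (eventA d n ∩ eventB d n ∩ eventC d n κ) := by
  set K : ℕ := 2 ^ d * (3 ^ d) ^ 4 * 2 ^ 5 with hK
  have hK1 : (1 : ℝ) ≤ K := by
    have : 1 ≤ K := Nat.one_le_iff_ne_zero.2 (by positivity)
    exact_mod_cast this
  set L : ℕ := max 10 ⌈1 / (1 - κ)⌉₊ with hL
  have hL10 : 10 ≤ L := le_max_left _ _
  have hL0 : (0 : ℝ) < L := by exact_mod_cast (by omega : 0 < L)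
  have hLκ : 1 ≤ (1 - κ) * L := by
    have h1 : 1 / (1 - κ) ≤ L :=
      (Nat.le_ceil _).trans (by exact_mod_cast le_max_right 10 ⌈1 / (1 - κ)⌉₊)
    rw [div_le_iff₀ (by linarith)] at h1
    linarith
  set β : ℝ := Real.exp (-1) / K with hβ
  have hβ0 : 0 < β := by positivity
  have hβ1 : β ≤ 1 := by
    rw [hβ, div_le_one (by positivity)]
    exact (Real.exp_le_one_iff.2 (by norm_num)).trans hK1
  refine ⟨max (1 / 2) (1 - β ^ (2 * L)), max_lt (by norm_num) (by
    have : 0 < β ^ (2 * L) := by positivity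
    linarith), fun p hp hp1 => ?_⟩
  have hp0 : 0 < p := lt_of_lt_of_le (by norm_num) ((le_max_left _ _).trans hp)
  have hpβ : 1 - p ≤ β ^ (2 * L) := by
    have := (le_max_right _ _).trans hp
    linarith
  set δ : ℝ := p ^ L ^ d with hδ
  have hδ0 : 0 < δ := by positivity
  refine ⟨min 1 (δ / L), by positivity, fun μ hμ n hn => ?_⟩
  have hn0 : (0 : ℝ) ≤ n := Nat.cast_nonneg n
  have := hμ.1
  rcases lt_or_ge n L with hnL | hnL
  · refine le_trans ?_ (measure_events_ge_of_all_open hd hn hκ1 hμ)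
    rw [← ENNReal.ofReal_one, ← ENNReal.ofReal_sub _ (Real.exp_pos _).le,
      ← ENNReal.ofReal_pow hp0.le]
    refine ENNReal.ofReal_le_ofReal ?_
    have h1 := Real.add_one_le_exp (-min 1 (δ / L) * n)
    have h2 : min 1 (δ / L) * n ≤ δ / L * L :=
      mul_le_mul (min_le_right _ _) (by exact_mod_cast hnL.le) hn0 (by positivity)
    rw [div_mul_cancel₀ _ hL0.ne'] at h2
    have h3 : δ ≤ p ^ n ^ d :=
      pow_le_pow_of_le_one hp0.le hp1.le (Nat.pow_le_pow_left hnL.le d)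
    linarith
  · have hs1 : 1 ≤ n / L := (Nat.one_le_div_iff (by omega)).2 hnL
    have hdiv := Nat.div_add_mod n L
    have hmod := Nat.mod_lt n (show 0 < L by omega)
    have hsL : L * (n / L) ≤ n := Nat.mul_div_le n L
    have hsκ : ((n / L : ℕ) : ℝ) - 1 ≤ (1 - κ) * n := by
      have h1 : (L : ℝ) * (n / L : ℕ) ≤ n := by exact_mod_cast hsL
      have h2 : (0 : ℝ) ≤ (n / L : ℕ) := Nat.cast_nonneg _
      nlinarith
    have hbad := measure_events_compl_le hd hn hμ (Nat.div_le_self n L)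
      ((Nat.div_le_div_left hL10 (by norm_num)).trans (Nat.le_succ _)) hsκ
    have hcount : n ^ d * ((3 ^ d) ^ (4 * n) * 2 ^ (4 * n + 1)) ≤ K ^ n := by
      have h1 : n ^ d ≤ (2 ^ d) ^ n := by
        rw [← pow_mul, mul_comm d n, pow_mul]
        exact Nat.pow_le_pow_left n.lt_two_pow_self.le d
      have h2 : (2 : ℕ) ^ (4 * n + 1) ≤ (2 ^ 5) ^ n := by
        rw [← pow_mul]
        exact Nat.pow_le_pow_right (by norm_num) (by omega)
      rw [hK, mul_pow, mul_pow, ← pow_mul (3 ^ d), mul_assoc]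
      exact Nat.mul_le_mul h1 (Nat.mul_le_mul le_rfl h2)
    have hexp : (K : ℝ) ^ n * (1 - p) ^ (n / L) ≤ Real.exp (-min 1 (δ / L) * n) := by
      calc (K : ℝ) ^ n * (1 - p) ^ (n / L)
          ≤ (K : ℝ) ^ n * (β ^ (2 * L)) ^ (n / L) := by
            gcongr
        _ ≤ (K : ℝ) ^ n * β ^ n := by
            rw [← pow_mul]
            refine mul_le_mul_of_nonneg_left ?_ (by positivity)
            refine pow_le_pow_of_le_one hβ0.le hβ1 ?_
            nlinarith
        _ = Real.exp (-n) := by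
            rw [← mul_pow, hβ, mul_div_cancel₀ _ (by positivity), ← Real.exp_nat_mul]
            simp
        _ ≤ Real.exp (-min 1 (δ / L) * n) := by
            refine Real.exp_le_exp.2 ?_
            have := mul_le_mul_of_nonneg_right (min_le_left 1 (δ / L)) hn0
            linarith
    have hbad' : μ (eventA d n ∩ eventB d n ∩ eventC d n κ)ᶜ ≤
        ENNReal.ofReal (Real.exp (-min 1 (δ / L) * n)) := by
      refine hbad.trans (le_trans ?_ (ENNReal.ofReal_le_ofReal hexp))
      rw [ENNReal.ofReal_mul (by positivity), ENNReal.ofReal_pow (by positivity),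
        ENNReal.ofReal_pow (by linarith)]
      gcongr
      rw [ENNReal.ofReal_natCast, ← Nat.cast_pow]
      exact_mod_cast hcount
    rw [tsub_le_iff_right, ← measure_univ (μ := μ),
      ← Set.union_compl_self (eventA d n ∩ eventB d n ∩ eventC d n κ)]
    exact (measure_union_le _ _).trans (by gcongr)

end
end

section
/- Let d ≥ 1, α > 0 and ρ > 0, and let P_{*,ρ} be the homogeneous Poisson point process of intensity ρ on ℝ^d. There exists a constant c₁ = c₁(ρ, α, d) such that for every n ∈ ℕ there is a finite constant C_n (depending on n, ρ, α, d) with P_{*,ρ}( R_{Λ_ℓ} ≥ γ·ℓ^d ) ≤ C_n·ℓ^{−nd} for all γ > c₁ and all ℓ ∈ ℕ. -/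
open MeasureTheory Filter
open scoped ENNReal

noncomputable section

abbrev Pt (d : ℕ) := EuclideanSpace ℝ (Fin d)
abbrev Config (d : ℕ) := Set (Pt d)

def IsLocallyFinite {d : ℕ} (ξ : Config d) : Prop :=
  ∀ A : Set (Pt d), Bornology.IsBounded A → (ξ ∩ A).Finite

instance configMS (d : ℕ) : MeasurableSpace (Config d) :=
  MeasurableSpace.generateFrom
    { E | ∃ (A : Set (Pt d)) (n : ℕ), Bornology.IsBounded A ∧ MeasurableSet A ∧
        E = {ξ : Config d | (ξ ∩ A).ncard = n} }

def IsPointProcess {d : ℕ} (P : Measure (Config d)) : Prop :=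
  IsProbabilityMeasure P ∧ ∀ᵐ ξ ∂P, IsLocallyFinite ξ

def cube (d : ℕ) (L : ℝ) : Set (Pt d) := {p | ∀ i, |p i| ≤ L / 2}

/-- The cube `B_x = Kx + [0,K)^d`. -/
def Kcube (d : ℕ) (K : ℝ) (x : Fin d → ℤ) : Set (Pt d) :=
  {p | ∀ i, K * x i ≤ p i ∧ p i < K * x i + K}

/-- Bernoulli(p) i.i.d. field on `ℤ^d`, characterized by its cylinder probabilities. -/
def IsBernoulliField (d : ℕ) (p : ℝ) (ν : Measure ((Fin d → ℤ) → Bool)) : Prop :=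
  IsProbabilityMeasure ν ∧
  ∀ (S : Finset (Fin d → ℤ)) (b : (Fin d → ℤ) → Bool),
    ν {ω | ∀ x ∈ S, ω x = b x} = ∏ x ∈ S, ENNReal.ofReal (if b x then p else 1 - p)

/-- Assumption (A1): for every p < 1 there is K such that the good-box field
dominates an i.i.d. Bernoulli(p) field, in the sense of a monotone coupling. -/
def AssumptionA1 {d : ℕ} (P : Measure (Config d)) : Prop :=
  ∀ p : ℝ, 0 < p → p < 1 → ∃ K : ℝ, 0 < K ∧
    ∃ (μ : Measure (Config d × ((Fin d → ℤ) → Bool))) (ν : Measure ((Fin d → ℤ) → Bool)),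
      IsProbabilityMeasure μ ∧ IsBernoulliField d p ν ∧
      μ.map Prod.fst = P ∧ μ.map Prod.snd = ν ∧
      ∀ᵐ ω ∂μ, ∀ x : Fin d → ℤ, ω.2 x = true → (ω.1 ∩ Kcube d K x).Nonempty

/-- `R_A(ξ) = Σ_{x ∈ ξ∩A} Σ_{y ∈ ξ} exp(-|x-y|^α)` (valued in `ℝ≥0∞`). -/
def Rfun {d : ℕ} (α : ℝ) (A : Set (Pt d)) (ξ : Config d) : ℝ≥0∞ :=
  ∑' (x : ↥(ξ ∩ A)) (y : ↥ξ), ENNReal.ofReal (Real.exp (-(dist (x : Pt d) (y : Pt d)) ^ α))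

/-- The cube `V_x = L^ε x + [0, L^ε)^d`. -/
def Vcube (d : ℕ) (L : ℕ) (ε : ℝ) (x : Fin d → ℤ) : Set (Pt d) :=
  {p | ∀ i, (L : ℝ) ^ ε * x i ≤ p i ∧ p i < (L : ℝ) ^ ε * x i + (L : ℝ) ^ ε}

/-- Assumption (A2). -/
def AssumptionA2 {d : ℕ} (α : ℝ) (P : Measure (Config d)) : Prop :=
  ∀ ε : ℝ, 0 < ε → ε < 1 → ∃ C : ℝ, 0 < C ∧
    ∀ᵐ ξ ∂P, ∀ᶠ L : ℕ in atTop,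
      ∀ x : Fin d → ℤ, (Vcube d L ε x ∩ cube d L).Nonempty →
        Rfun α (Vcube d L ε x) ξ ≤ ENNReal.ofReal (C * (L : ℝ) ^ (ε * d))

/-- homogeneous Poisson point process of intensity `ρ`, characterized by
independence and Poisson distribution of the counting variables. -/
def IsPoissonPP (d : ℕ) (ρ : ℝ) (P : Measure (Config d)) : Prop :=
  IsProbabilityMeasure P ∧ (∀ᵐ ξ ∂P, IsLocallyFinite ξ) ∧
  ∀ (k : ℕ) (A : Fin k → Set (Pt d)),
    (∀ j, Bornology.IsBounded (A j)) → (∀ j, MeasurableSet (A j)) →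
    (Pairwise fun j j' => Disjoint (A j) (A j')) →
    ∀ m : Fin k → ℕ,
      P {ξ | ∀ j, (ξ ∩ A j).ncard = m j} =
        ∏ j, ENNReal.ofReal (Real.exp (-ρ * (volume (A j)).toReal) *
          (ρ * (volume (A j)).toReal) ^ (m j) / ((m j).factorial : ℝ))

open ProbabilityTheory


lemma pow_abs_le_one_add_pow (x : ℝ) {m n : ℕ} (h : m ≤ 2 * n) : |x| ^ m ≤ 1 + x ^ (2 * n) := by
  rw [← (even_two_mul n).pow_abs]
  rcases le_total |x| 1 with hx | hx
  · have := pow_le_one₀ (n := m) (abs_nonneg x) hx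
    have := pow_nonneg (abs_nonneg x) (2 * n)
    linarith
  · have := pow_le_pow_right₀ hx h
    linarith

lemma exists_add_pow_le (n : ℕ) : ∃ D : ℝ, 0 ≤ D ∧ ∀ s x : ℝ,
    (s + x) ^ (2 * (n + 1)) ≤ s ^ (2 * (n + 1)) + (2 * (n + 1)) * (s ^ (2 * n + 1) * x)
      + D * ((1 + s ^ (2 * n)) * (x ^ 2 + x ^ (2 * (n + 1)))) := by
  refine ⟨∑ m ∈ Finset.range (2 * n + 1), ((2 * (n + 1)).choose (m + 2) : ℝ),
    Finset.sum_nonneg fun _ _ => by positivity, fun s x => ?_⟩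
  have key : ∑ m ∈ Finset.range (2 * n + 1),
      x ^ (m + 2) * s ^ (2 * (n + 1) - (m + 2)) * ((2 * (n + 1)).choose (m + 2) : ℝ) ≤
      (∑ m ∈ Finset.range (2 * n + 1), ((2 * (n + 1)).choose (m + 2) : ℝ)) *
        ((1 + s ^ (2 * n)) * (x ^ 2 + x ^ (2 * (n + 1)))) := by
    rw [Finset.sum_mul]
    refine Finset.sum_le_sum fun m hm => ?_
    rw [Finset.mem_range] at hm
    rw [mul_comm]
    refine mul_le_mul_of_nonneg_left ?_ (Nat.cast_nonneg _)
    have h1 := pow_abs_le_one_add_pow x (show m ≤ 2 * n by omega)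
    have h2 := pow_abs_le_one_add_pow s (show 2 * (n + 1) - (m + 2) ≤ 2 * n by omega)
    have h3 := (even_two_mul n).pow_nonneg s
    calc x ^ (m + 2) * s ^ (2 * (n + 1) - (m + 2))
        ≤ |x ^ (m + 2) * s ^ (2 * (n + 1) - (m + 2))| := le_abs_self _
      _ = |s| ^ (2 * (n + 1) - (m + 2)) * (x ^ 2 * |x| ^ m) := by
          rw [abs_mul, abs_pow, abs_pow, pow_add |x| m 2, sq_abs]; ring
      _ ≤ (1 + s ^ (2 * n)) * (x ^ 2 * (1 + x ^ (2 * n))) := by gcongr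
      _ = _ := by ring
  rw [add_comm s x, add_pow, show 2 * (n + 1) + 1 = (2 * n + 1) + 1 + 1 by ring,
    Finset.sum_range_succ', Finset.sum_range_succ']
  simp only [add_assoc, one_add_one_eq_two] at key ⊢
  have e : 2 * (n + 1) - (0 + 1) = 2 * n + 1 := by omega
  rw [e]
  simp only [zero_add, pow_one, Nat.choose_one_right, pow_zero, Nat.choose_zero_right,
    Nat.sub_zero]
  push_cast
  linarith

lemma integrable_pow_of_forall_memLp {Ω : Type*} [MeasurableSpace Ω] {P : Measure Ω}
    [IsFiniteMeasure P] {f : Ω → ℝ} (hf : ∀ p : ℕ, MemLp f p P) (p : ℕ) :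
    Integrable (fun ω => f ω ^ p) P :=
  (hf p).integrable_norm_pow'.mono ((hf 0).1.pow p) (ae_of_all _ fun ω => by simp)

/-- A Rosenthal-type moment bound for sums of independent centred random variables. -/
lemma exists_integral_sum_pow_le {Ω ι : Type*} [MeasurableSpace Ω] (P : Measure Ω)
    [IsProbabilityMeasure P] (K : ℕ → ℝ) (hK : ∀ n, 0 ≤ K n) (n : ℕ) :
    ∃ C : ℝ, 0 ≤ C ∧ ∀ (W : ι → Ω → ℝ) (b : ι → ℝ), iIndepFun W P → (∀ i, Measurable (W i)) →
      (∀ i (p : ℕ), MemLp (W i) p P) → (∀ i, ∫ ω, W i ω ∂P = 0) → (∀ i, 0 ≤ b i) →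
      (∀ i k, ∫ ω, (W i ω ^ 2 + W i ω ^ (2 * (k + 1))) ∂P ≤ b i * K k) →
      ∀ (F : Finset ι) (T : ℝ), 1 ≤ T → ∑ i ∈ F, b i ≤ T →
        ∫ ω, (∑ i ∈ F, W i ω) ^ (2 * n) ∂P ≤ C * T ^ n := by
  classical
  induction n with
  | zero => exact ⟨1, zero_le_one, fun _ _ _ _ _ _ _ _ _ _ _ _ => by simp⟩
  | succ n ih =>
    obtain ⟨C, hC, ih⟩ := ih
    obtain ⟨D, hD, hDle⟩ := exists_add_pow_le n
    have hL : 0 ≤ D * (1 + C) * K n := mul_nonneg (by positivity) (hK _)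
    refine ⟨D * (1 + C) * K n, hL, fun W b hind hmeas hLp hzero hb hbK F T hT hF => ?_⟩
    suffices h : ∀ G : Finset ι, ∑ i ∈ G, b i ≤ T →
        ∫ ω, (∑ i ∈ G, W i ω) ^ (2 * (n + 1)) ∂P ≤
          D * (1 + C) * K n * T ^ n * ∑ i ∈ G, b i by
      refine (h F hF).trans ?_
      rw [pow_succ, ← mul_assoc]
      gcongr
    intro G
    induction G using Finset.induction_on with
    | empty => simp
    | insert a G ha ihG =>
      intro hGT
      rw [Finset.sum_insert ha] at hGT
      have hGT' : ∑ i ∈ G, b i ≤ T := by linarith [hb a]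
      set S : Ω → ℝ := fun ω => ∑ i ∈ G, W i ω with hS
      have hSLp : ∀ p : ℕ, MemLp S p P := fun p => memLp_finsetSum G fun i _ => hLp i p
      have hSW : IndepFun S (W a) P := by
        have := hind.indepFun_finsetSum_of_notMem hmeas ha
        convert this using 1
        ext ω; simp [hS]
      have hi1 := integrable_pow_of_forall_memLp hSLp (2 * (n + 1))
      have hW2 : Integrable (fun ω => W a ω ^ 2 + W a ω ^ (2 * (n + 1))) P :=
        (integrable_pow_of_forall_memLp (hLp a) _).add (integrable_pow_of_forall_memLp (hLp a) _)
      have hS2 : Integrable (fun ω => 1 + S ω ^ (2 * n)) P :=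
        (integrable_const _).add (integrable_pow_of_forall_memLp hSLp _)
      have hWi : Integrable (W a) P := by simpa using integrable_pow_of_forall_memLp (hLp a) 1
      have ind1 : IndepFun (fun ω => S ω ^ (2 * n + 1)) (W a) P :=
        hSW.comp (φ := fun x : ℝ => x ^ (2 * n + 1)) (ψ := id) (by fun_prop) measurable_id
      have ind2 : IndepFun (fun ω => 1 + S ω ^ (2 * n))
          (fun ω => W a ω ^ 2 + W a ω ^ (2 * (n + 1))) P :=
        hSW.comp (φ := fun x : ℝ => 1 + x ^ (2 * n))
          (ψ := fun x : ℝ => x ^ 2 + x ^ (2 * (n + 1))) (by fun_prop) (by fun_prop)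
      have hi2 := ind1.integrable_mul (integrable_pow_of_forall_memLp hSLp _) hWi
      have hi3 := ind2.integrable_mul hS2 hW2
      simp only [Pi.mul_def] at hi2 hi3
      have hi12 : Integrable (fun ω => S ω ^ (2 * (n + 1))
          + (2 * (n + 1)) * (S ω ^ (2 * n + 1) * W a ω)) P := hi1.add (hi2.const_mul _)
      have e2 : ∫ ω, S ω ^ (2 * n + 1) * W a ω ∂P = 0 := by
        rw [ind1.integral_fun_mul_eq_mul_integral (integrable_pow_of_forall_memLp hSLp _).1 hWi.1, hzero a, mul_zero]
      have e3 : ∫ ω, (1 + S ω ^ (2 * n)) * (W a ω ^ 2 + W a ω ^ (2 * (n + 1))) ∂P ≤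
          ((1 + C) * T ^ n) * (b a * K n) := by
        rw [ind2.integral_fun_mul_eq_mul_integral hS2.1 hW2.1]
        have h1 : ∫ ω, (1 + S ω ^ (2 * n)) ∂P ≤ (1 + C) * T ^ n := by
          rw [integral_add (integrable_const _) (integrable_pow_of_forall_memLp hSLp _)]
          have := ih W b hind hmeas hLp hzero hb hbK G T hT hGT'
          have := one_le_pow₀ (n := n) hT
          simp only [integral_const, probReal_univ, one_smul, hS]
          linarith
        refine mul_le_mul h1 (hbK a _) (integral_nonneg fun ω => ?_) (by positivity)
        have := (even_two_mul (n + 1)).pow_nonneg (W a ω)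
        simp only [Pi.zero_apply]
        positivity
      calc ∫ ω, (∑ i ∈ insert a G, W i ω) ^ (2 * (n + 1)) ∂P
          = ∫ ω, (S ω + W a ω) ^ (2 * (n + 1)) ∂P := by
            simp only [Finset.sum_insert ha, hS, add_comm]
        _ ≤ ∫ ω, (S ω ^ (2 * (n + 1)) + (2 * (n + 1)) * (S ω ^ (2 * n + 1) * W a ω)
              + D * ((1 + S ω ^ (2 * n)) * (W a ω ^ 2 + W a ω ^ (2 * (n + 1))))) ∂P := by
            refine integral_mono (integrable_pow_of_forall_memLp (fun p => (hSLp p).add (hLp a p)) _)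
              (hi12.add (hi3.const_mul _)) fun ω => hDle _ _
        _ = ∫ ω, S ω ^ (2 * (n + 1)) ∂P
              + D * ∫ ω, (1 + S ω ^ (2 * n)) * (W a ω ^ 2 + W a ω ^ (2 * (n + 1))) ∂P := by
            rw [integral_add hi12 (hi3.const_mul _),
              integral_add hi1 (hi2.const_mul _), integral_const_mul, integral_const_mul, e2]
            ring
        _ ≤ D * (1 + C) * K n * T ^ n * ∑ i ∈ G, b i
              + D * (((1 + C) * T ^ n) * (b a * K n)) := by
            gcongr
            exact ihG hGT'
        _ = _ := by rw [Finset.sum_insert ha]; ring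


lemma Kcube_one_eq_preimage (d : ℕ) (w : Fin d → ℤ) :
    Kcube d 1 w = (WithLp.ofLp : Pt d → Fin d → ℝ) ⁻¹'
      (Set.univ.pi fun i => Set.Ico (w i : ℝ) (w i + 1)) := by
  ext p; simp [Kcube]

lemma measurableSet_Kcube_one (d : ℕ) (w : Fin d → ℤ) : MeasurableSet (Kcube d 1 w) := by
  rw [Kcube_one_eq_preimage]
  exact (PiLp.volume_preserving_ofLp (Fin d)).measurable
    (MeasurableSet.univ_pi fun _ => measurableSet_Ico)

lemma volume_Kcube_one (d : ℕ) (w : Fin d → ℤ) : volume (Kcube d 1 w) = 1 := by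
  rw [Kcube_one_eq_preimage, (PiLp.volume_preserving_ofLp (Fin d)).measure_preimage
    (MeasurableSet.univ_pi fun _ => measurableSet_Ico).nullMeasurableSet, volume_pi_pi]
  simp

lemma isBounded_Kcube_one (d : ℕ) (w : Fin d → ℤ) : Bornology.IsBounded (Kcube d 1 w) := by
  rw [Kcube_one_eq_preimage]
  refine (PiLp.antilipschitzWith_ofLp 2 fun _ : Fin d => ℝ).isBounded_preimage ?_
  exact Bornology.IsBounded.pi fun _ => Metric.isBounded_Ico _ _

/-- The number of points of `ξ` in the unit cube with lower corner `w`. -/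
def cubeCount {d : ℕ} (w : Fin d → ℤ) (ξ : Config d) : ℕ := (ξ ∩ Kcube d 1 w).ncard

lemma measurable_cubeCount {d : ℕ} (w : Fin d → ℤ) :
    Measurable (cubeCount w : Config d → ℕ) :=
  measurable_to_countable' fun n => MeasurableSpace.measurableSet_generateFrom
    ⟨Kcube d 1 w, n, isBounded_Kcube_one d w, measurableSet_Kcube_one d w, rfl⟩

lemma pairwise_disjoint_Kcube_one (d : ℕ) :
    Pairwise fun w w' : Fin d → ℤ => Disjoint (Kcube d 1 w) (Kcube d 1 w') := by
  intro w w' hne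
  rw [Set.disjoint_left]
  intro p hp hp'
  refine hne (funext fun i => ?_)
  have h1 := hp i
  have h2 := hp' i
  simp only [one_mul] at h1 h2
  exact (Int.floor_eq_iff.2 h1).symm.trans (Int.floor_eq_iff.2 h2)

section Poisson

variable {d : ℕ} {r : NNReal} {P : Measure (Config d)}

lemma IsPoissonPP.measure_cubeCount_eq (hP : IsPoissonPP d r P) {k : ℕ}
    {g : Fin k → Fin d → ℤ} (hg : g.Injective) (m : Fin k → ℕ) :
    P {ξ | ∀ j, cubeCount (g j) ξ = m j} =
      ∏ j, ENNReal.ofReal (Real.exp (-r) * r ^ m j / ((m j).factorial : ℝ)) := by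
  have := hP.2.2 k (fun j => Kcube d 1 (g j)) (fun j => isBounded_Kcube_one d _)
    (fun j => measurableSet_Kcube_one d _)
    (fun i j hij => pairwise_disjoint_Kcube_one d (hg.ne hij)) m
  simpa only [volume_Kcube_one, ENNReal.toReal_one, mul_one, cubeCount] using this

lemma IsPoissonPP.map_cubeCount (hP : IsPoissonPP d r P) (w : Fin d → ℤ) :
    P.map (cubeCount w) = poissonMeasure r := by
  refine Measure.ext_of_singleton fun n => ?_
  rw [Measure.map_apply (measurable_cubeCount w) (measurableSet_singleton n),
    poissonMeasure_singleton]
  have := hP.measure_cubeCount_eq (k := 1) (g := fun _ => w)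
    (Function.injective_of_subsingleton _) (fun _ => n)
  simpa [Set.preimage] using this

lemma IsPoissonPP.iIndepFun_cubeCount (hP : IsPoissonPP d r P) :
    iIndepFun (fun w : Fin d → ℤ => (cubeCount w : Config d → ℕ)) P := by
  have := hP.1
  rw [iIndepFun_iff_finset]
  intro s
  let e := s.equivFin
  rw [← iIndepFun_precomp_of_bijective e.symm.bijective]
  simp only [Finset.restrict]
  rw [iIndepFun_iff_map_fun_eq_pi_map fun i => (measurable_cubeCount _).aemeasurable]
  have hg : Function.Injective fun j => (e.symm j : Fin d → ℤ) :=
    Subtype.val_injective.comp e.symm.injective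
  refine Measure.ext_of_singleton fun m => ?_
  rw [Measure.map_apply (measurable_pi_lambda _ fun i => measurable_cubeCount _)
    (measurableSet_singleton m), Measure.pi_singleton]
  have h := hP.measure_cubeCount_eq hg m
  simp only [hP.map_cubeCount, poissonMeasure_singleton]
  convert h using 2
  ext ξ
  simp [funext_iff]

lemma integrable_pow_poissonMeasure (r : NNReal) (k : ℕ) :
    Integrable (fun n : ℕ => (n : ℝ) ^ k) (poissonMeasure r) := by
  rw [integrable_poissonMeasure_iff]
  have hs : Summable fun n : ℕ =>
      (k.factorial * Real.exp (-r)) * ((r * Real.exp 1) ^ n / (n.factorial : ℝ)) :=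
    (Real.summable_pow_div_factorial _).mul_left _
  refine hs.of_nonneg_of_le (fun n => by positivity) fun n => ?_
  have h1 : (n : ℝ) ^ k ≤ k.factorial * Real.exp n := by
    have := Real.pow_div_factorial_le_exp (n : ℝ) (Nat.cast_nonneg n) k
    rwa [div_le_iff₀ (by positivity), mul_comm] at this
  have h2 : Real.exp n = Real.exp 1 ^ n := by rw [← Real.exp_nat_mul, mul_one]
  rw [h2] at h1
  rw [Real.norm_of_nonneg (by positivity)]
  calc _ ≤ Real.exp (-r) * r ^ n / (n.factorial : ℝ) * (k.factorial * Real.exp 1 ^ n) := by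
        gcongr
    _ = _ := by rw [mul_pow]; ring

lemma IsPoissonPP.memLp_sq_cubeCount (hP : IsPoissonPP d r P) (w : Fin d → ℤ)
    (p : ℕ) : MemLp (fun ξ => (cubeCount w ξ : ℝ) ^ 2) p P := by
  have := hP.1
  have h : MemLp (fun n : ℕ => (n : ℝ) ^ 2) p (P.map (cubeCount w)) := by
    rw [hP.map_cubeCount]
    rcases eq_or_ne p 0 with rfl | hp
    · simpa using (Measurable.of_discrete (f := fun n : ℕ => (n : ℝ) ^ 2)).aestronglyMeasurable
    · rw [← integrable_norm_rpow_iff Measurable.of_discrete.aestronglyMeasurable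
        (by simpa using hp) (by simp)]
      convert integrable_pow_poissonMeasure r (2 * p) using 2 with n
      simp [pow_mul]
  exact h.comp_of_map (measurable_cubeCount w).aemeasurable

/-- Moment bound for weighted sums of centred squared cube counts, uniform in the weights. -/
lemma IsPoissonPP.exists_integral_weighted_sum_le (hP : IsPoissonPP d r P) (B : ℝ)
    (n : ℕ) :
    ∃ C : ℝ, 0 ≤ C ∧ ∀ b : (Fin d → ℤ) → ℝ, (∀ w, 0 ≤ b w) → (∀ w, b w ≤ B) →
      ∀ (F : Finset (Fin d → ℤ)) (T : ℝ), 1 ≤ T → ∑ w ∈ F, b w ≤ T →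
        Integrable (fun ξ => (∑ w ∈ F, b w * ((cubeCount w ξ : ℝ) ^ 2
          - ∫ m : ℕ, (m : ℝ) ^ 2 ∂poissonMeasure r)) ^ (2 * n)) P ∧
        ∫ ξ, (∑ w ∈ F, b w * ((cubeCount w ξ : ℝ) ^ 2
          - ∫ m : ℕ, (m : ℝ) ^ 2 ∂poissonMeasure r)) ^ (2 * n) ∂P ≤ C * T ^ n := by
  have := hP.1
  set ν := poissonMeasure r with hν
  set μ := ∫ m : ℕ, (m : ℝ) ^ 2 ∂ν with hμ
  set M : ℕ → ℝ := fun k => ∫ m : ℕ, ((m : ℝ) ^ 2 - μ) ^ k ∂ν with hM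
  have hM0 : ∀ k, 0 ≤ M (2 * k) := fun k =>
    integral_nonneg fun m => (even_two_mul k).pow_nonneg _
  have hint : ∀ w k, ∫ ξ, ((cubeCount w ξ : ℝ) ^ 2 - μ) ^ k ∂P = M k := fun w k => by
    simp only [hM, hν]
    rw [← hP.map_cubeCount w,
      integral_map (measurable_cubeCount w).aemeasurable
        Measurable.of_discrete.aestronglyMeasurable]
  have hLp : ∀ w (p : ℕ), MemLp (fun ξ => (cubeCount w ξ : ℝ) ^ 2 - μ) p P := fun w p =>
    (hP.memLp_sq_cubeCount w p).sub (memLp_const μ)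
  obtain ⟨C, hC, h⟩ := exists_integral_sum_pow_le (ι := Fin d → ℤ) P
    (fun k => |B| * M (2 * 1) + |B| ^ (2 * k + 1) * M (2 * (k + 1)))
    (fun k => by have := hM0 1; have := hM0 (k + 1); positivity) n
  refine ⟨C, hC, fun b hb hbB F T hT hF => ⟨integrable_pow_of_forall_memLp (fun p => memLp_finsetSum F fun w _ =>
    (hLp w p).const_mul (b w)) _, ?_⟩⟩
  refine h (fun w ξ => b w * ((cubeCount w ξ : ℝ) ^ 2 - μ)) b ?_ (fun w => ?_)
    (fun w p => (hLp w p).const_mul (b w)) (fun w => ?_) hb (fun w k => ?_) F T hT hF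
  · exact hP.iIndepFun_cubeCount.comp (fun w (m : ℕ) => b w * ((m : ℝ) ^ 2 - μ))
      fun _ => Measurable.of_discrete
  · exact (Measurable.of_discrete (f := fun m : ℕ => b w * ((m : ℝ) ^ 2 - μ))).comp
      (measurable_cubeCount w)
  · have h1 := hint w 1
    simp only [pow_one, hM] at h1
    rw [integral_const_mul, h1, integral_sub (integrable_pow_poissonMeasure r 2)
      (integrable_const _)]
    simp [hμ, hν]
  · have hbw : b w ≤ |B| := (hbB w).trans (le_abs_self B)
    have h1 := hM0 1
    have h2 := hM0 (k + 1)
    simp only [mul_pow]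
    rw [integral_add ((integrable_pow_of_forall_memLp (hLp w) _).const_mul _) ((integrable_pow_of_forall_memLp (hLp w) _).const_mul _),
      integral_const_mul, integral_const_mul, hint, hint]
    calc b w ^ 2 * M 2 + b w ^ (2 * (k + 1)) * M (2 * (k + 1))
        = b w * (b w * M (2 * 1) + b w ^ (2 * k + 1) * M (2 * (k + 1))) := by ring
      _ ≤ _ := by have := hb w; gcongr
end Poisson

/-- The index of the unit cube containing a point. -/
def cubeIndex {d : ℕ} (p : Pt d) : Fin d → ℤ := fun i => ⌊p i⌋

lemma mem_Kcube_one_iff {d : ℕ} {p : Pt d} {w : Fin d → ℤ} :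
    p ∈ Kcube d 1 w ↔ cubeIndex p = w := by
  simp [Kcube, cubeIndex, funext_iff, Int.floor_eq_iff]

lemma tsum_cubeIndex_le {d : ℕ} {s ξ : Config d} (hξ : IsLocallyFinite ξ) (hs : s ⊆ ξ)
    (G : (Fin d → ℤ) → ℝ≥0∞) :
    ∑' x : s, G (cubeIndex (x : Pt d)) ≤ ∑' w, G w * (cubeCount w ξ : ℝ≥0∞) := by
  rw [← (Equiv.sigmaFiberEquiv fun x : s => cubeIndex (x : Pt d)).tsum_eq, ENNReal.tsum_sigma']
  refine ENNReal.tsum_le_tsum fun w => ?_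
  have h1 : ∀ y : {x : s // cubeIndex (x : Pt d) = w},
      G (cubeIndex (((Equiv.sigmaFiberEquiv fun x : s => cubeIndex (x : Pt d)) ⟨w, y⟩ : s)
        : Pt d)) = G w := fun y => by
    simp only [Equiv.sigmaFiberEquiv_apply]; rw [y.2]
  rw [tsum_congr h1, ENNReal.tsum_const, mul_comm]
  gcongr
  have hfin : (ξ ∩ Kcube d 1 w).Finite := hξ _ (isBounded_Kcube_one d w)
  have hle : ENat.card {x : s // cubeIndex (x : Pt d) = w} ≤ (ξ ∩ Kcube d 1 w).encard := by
    refine ENat.card_le_card_of_injective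
      (f := fun y => (⟨y.1, hs y.1.2, mem_Kcube_one_iff.2 y.2⟩ : ↥(ξ ∩ Kcube d 1 w))) ?_
    intro y y' h
    exact Subtype.ext (Subtype.ext (congrArg (fun q : ↥(ξ ∩ Kcube d 1 w) => (q : Pt d)) h))
  rw [cubeCount]
  rw [← hfin.cast_ncard_eq] at hle
  exact_mod_cast hle

/-- A decoupled majorant of the interaction between two unit cubes at index distance `v`. -/
def cubeKernel (d : ℕ) (α : ℝ) (v : Fin d → ℤ) : ℝ≥0∞ :=
  ∏ i, ENNReal.ofReal (Real.exp (-((max (|(v i : ℝ)| - 1) 0) ^ α / d)))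

lemma ofReal_exp_neg_dist_le {d : ℕ} (hd : 1 ≤ d) {α : ℝ} (hα : 0 < α) (x y : Pt d) :
    ENNReal.ofReal (Real.exp (-(dist x y) ^ α)) ≤
      cubeKernel d α (cubeIndex y - cubeIndex x) := by
  rw [cubeKernel, ← ENNReal.ofReal_prod_of_nonneg fun _ _ => (Real.exp_pos _).le, ← Real.exp_sum]
  refine ENNReal.ofReal_le_ofReal (Real.exp_le_exp.2 ?_)
  rw [Finset.sum_neg_distrib, neg_le_neg_iff]
  have h : ∀ i ∈ Finset.univ (α := Fin d),
      (max (|(((cubeIndex y - cubeIndex x) i : ℤ) : ℝ)| - 1) 0) ^ α / d ≤ dist x y ^ α / d := by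
    intro i _
    have h1 : |x i - y i| ≤ dist x y := by
      rw [dist_eq_norm]
      simpa using PiLp.norm_apply_le (x - y) i
    gcongr
    refine max_le ?_ dist_nonneg
    refine le_trans ?_ h1
    have a1 := Int.floor_le (x i)
    have a2 := Int.lt_floor_add_one (x i)
    have a3 := Int.floor_le (y i)
    have a4 := Int.lt_floor_add_one (y i)
    simp only [Pi.sub_apply, cubeIndex, Int.cast_sub]
    rw [sub_le_iff_le_add, abs_le]
    rw [abs_sub_comm]
    have := abs_le.1 (le_refl |y i - x i|)
    constructor <;> linarith
  refine (Finset.sum_le_sum h).trans ?_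
  have : (d : ℝ) ≠ 0 := by positivity
  rw [Finset.sum_const, Finset.card_univ, Fintype.card_fin, nsmul_eq_mul, mul_div_cancel₀ _ this]

lemma summable_exp_neg_natCast_rpow {α c : ℝ} (hα : 0 < α) (hc : 0 < c) :
    Summable fun n : ℕ => Real.exp (-((n : ℝ) ^ α * c)) := by
  obtain ⟨k, hk⟩ := exists_nat_gt (2 / α)
  have hk' : 2 < α * k := by rwa [div_lt_iff₀ hα, mul_comm] at hk
  have hs : Summable fun n : ℕ => (k.factorial / c ^ k) * (1 / (n : ℝ) ^ (α * k)) :=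
    (Real.summable_one_div_nat_rpow.2 (by linarith)).mul_left _
  refine hs.of_norm_bounded_eventually_nat ?_
  filter_upwards [eventually_ge_atTop 1] with n hn
  have hn' : (0 : ℝ) < n := by exact_mod_cast hn
  rw [Real.norm_of_nonneg (Real.exp_pos _).le, Real.exp_neg]
  have h := Real.pow_div_factorial_le_exp ((n : ℝ) ^ α * c) (by positivity) k
  rw [mul_pow, ← Real.rpow_mul_natCast hn'.le] at h
  calc (Real.exp ((n : ℝ) ^ α * c))⁻¹ ≤ ((n : ℝ) ^ (α * k) * c ^ k / k.factorial)⁻¹ :=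
        inv_anti₀ (by positivity) h
    _ = _ := by field_simp

lemma tsum_cubeKernel_ne_top {d : ℕ} (hd : 1 ≤ d) {α : ℝ} (hα : 0 < α) :
    ∑' v, cubeKernel d α v ≠ ∞ := by
  set g : ℤ → ℝ := fun v => Real.exp (-((max (|(v : ℝ)| - 1) 0) ^ α / d)) with hg
  have hd0 : (0 : ℝ) < d := by exact_mod_cast hd
  have hnat : Summable fun n : ℕ => Real.exp (-((max (|(n : ℝ)| - 1) 0) ^ α / d)) := by
    rw [← summable_nat_add_iff 1]
    refine (summable_exp_neg_natCast_rpow hα (inv_pos.2 hd0)).congr fun n => ?_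
    rw [div_eq_mul_inv, Nat.cast_add, Nat.cast_one, abs_of_nonneg (by positivity),
      add_sub_cancel_right, max_eq_left (Nat.cast_nonneg _)]
  have hsum : Summable g := by
    refine Summable.of_nat_of_neg ?_ ?_ <;> simpa [hg] using hnat
  have hpi : (Measure.pi fun _ : Fin d => (Measure.count : Measure ℤ)) = Measure.count := by
    refine Measure.ext_of_singleton fun v => ?_
    rw [Measure.pi_singleton]; simp
  have hprod : Summable fun v : Fin d → ℤ => ∏ i, g (v i) := by
    have := Integrable.fintype_prod (f := fun _ : Fin d => g)
      (μ := fun _ => (Measure.count : Measure ℤ)) fun _ => integrable_count_iff.2 hsum.norm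
    rw [hpi] at this
    exact (integrable_count_iff.1 this).of_norm
  have h1 : ∀ v, cubeKernel d α v = ENNReal.ofReal (∏ i, g (v i)) := fun v =>
    (ENNReal.ofReal_prod_of_nonneg fun _ _ => (Real.exp_pos _).le).symm
  rw [tsum_congr h1, ← ENNReal.ofReal_tsum_of_nonneg
    (fun v => Finset.prod_nonneg fun _ _ => (Real.exp_pos _).le) hprod]
  exact ENNReal.ofReal_ne_top

/-- The weight of the squared count of the cube `w` in a majorant of `Rfun` over a region covered
by the cubes with index in `Z`. -/
def cubeWeight (d : ℕ) (α : ℝ) (Z : Finset (Fin d → ℤ)) (w : Fin d → ℤ) : ℝ≥0∞ :=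
  ∑ z ∈ Z, cubeKernel d α (w - z) + (Z : Set (Fin d → ℤ)).indicator
    (fun _ => ∑' v, cubeKernel d α v) w

lemma cubeWeight_le (d : ℕ) (α : ℝ) (Z : Finset (Fin d → ℤ)) (w : Fin d → ℤ) :
    cubeWeight d α Z w ≤ 2 * ∑' v, cubeKernel d α v := by
  rw [two_mul]
  refine add_le_add ?_ (Set.indicator_le_self' (fun _ _ => zero_le) w)
  calc ∑ z ∈ Z, cubeKernel d α (w - z) ≤ ∑' z, cubeKernel d α (w - z) := ENNReal.sum_le_tsum Z
    _ = _ := (Equiv.subLeft w).tsum_eq (cubeKernel d α)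

lemma tsum_cubeKernel_sub (d : ℕ) (α : ℝ) (z : Fin d → ℤ) :
    ∑' w, cubeKernel d α (w - z) = ∑' v, cubeKernel d α v :=
  (Equiv.subRight z).tsum_eq (cubeKernel d α)

lemma tsum_indicator_finset_mul {ι : Type*} (Z : Finset ι) (f g : ι → ℝ≥0∞) :
    ∑' w, (Z : Set ι).indicator f w * g w = ∑ z ∈ Z, f z * g z := by
  rw [tsum_eq_sum (s := Z) fun w hw => by simp [hw]]
  exact Finset.sum_congr rfl fun z hz => by simp [hz]

lemma tsum_cubeWeight (d : ℕ) (α : ℝ) (Z : Finset (Fin d → ℤ)) :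
    ∑' w, cubeWeight d α Z w = 2 * Z.card * ∑' v, cubeKernel d α v := by
  have h := tsum_indicator_finset_mul Z (fun _ => ∑' v, cubeKernel d α v) 1
  simp only [Pi.one_apply, mul_one] at h
  simp only [cubeWeight]
  rw [ENNReal.tsum_add, h, Summable.tsum_finsetSum fun _ _ => ENNReal.summable]
  simp only [tsum_cubeKernel_sub, Finset.sum_const, nsmul_eq_mul]
  ring

lemma Rfun_le_tsum_cubeWeight {d : ℕ} (hd : 1 ≤ d) {α : ℝ} (hα : 0 < α) {ξ : Config d}
    (hξ : IsLocallyFinite ξ) {A : Set (Pt d)} {Z : Finset (Fin d → ℤ)}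
    (hZ : ∀ p ∈ A, cubeIndex p ∈ Z) :
    Rfun α A ξ ≤ ∑' w, cubeWeight d α Z w * (cubeCount w ξ : ℝ≥0∞) ^ 2 := by
  set H : (Fin d → ℤ) → ℝ≥0∞ := fun z =>
    ∑' w, cubeKernel d α (w - z) * (cubeCount w ξ : ℝ≥0∞) with hH
  calc Rfun α A ξ ≤ ∑' x : ↥(ξ ∩ A), (Z : Set (Fin d → ℤ)).indicator H (cubeIndex (x : Pt d)) := by
        refine ENNReal.tsum_le_tsum fun x => ?_
        rw [Set.indicator_of_mem (by exact_mod_cast hZ _ x.2.2)]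
        refine (ENNReal.tsum_le_tsum fun y => ofReal_exp_neg_dist_le hd hα _ _).trans ?_
        exact tsum_cubeIndex_le hξ subset_rfl
          fun w => cubeKernel d α (w - cubeIndex (x : Pt d))
    _ ≤ ∑' w, (Z : Set (Fin d → ℤ)).indicator H w * (cubeCount w ξ : ℝ≥0∞) :=
        tsum_cubeIndex_le hξ Set.inter_subset_left _
    _ = ∑ z ∈ Z, H z * (cubeCount z ξ : ℝ≥0∞) := tsum_indicator_finset_mul _ _ _
    _ ≤ ∑ z ∈ Z, (∑' w, cubeKernel d α (w - z) * (cubeCount w ξ : ℝ≥0∞) ^ 2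
          + (∑' v, cubeKernel d α v) * (cubeCount z ξ : ℝ≥0∞) ^ 2) := by
        refine Finset.sum_le_sum fun z _ => ?_
        rw [← tsum_cubeKernel_sub d α z, ← ENNReal.tsum_mul_right, ← ENNReal.tsum_mul_right,
          ← ENNReal.tsum_add]
        refine ENNReal.tsum_le_tsum fun w => ?_
        rw [mul_assoc, ← mul_add]
        gcongr
        have : cubeCount w ξ * cubeCount z ξ ≤ cubeCount w ξ ^ 2 + cubeCount z ξ ^ 2 := by
          nlinarith [two_mul_le_add_sq (cubeCount w ξ) (cubeCount z ξ)]
        exact_mod_cast this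
    _ = _ := by
        simp only [cubeWeight, add_mul]
        rw [ENNReal.tsum_add, tsum_indicator_finset_mul, Finset.sum_add_distrib]
        simp only [Finset.sum_mul]
        rw [Summable.tsum_finsetSum fun _ _ => ENNReal.summable]

lemma cubeIndex_mem_piFinset {d : ℕ} (ℓ : ℕ) {p : Pt d} (hp : p ∈ cube d ℓ) :
    cubeIndex p ∈ Fintype.piFinset fun _ : Fin d => Finset.Icc (-(ℓ : ℤ)) ℓ := by
  rw [Fintype.mem_piFinset]
  intro i
  have h := abs_le.1 (hp i)
  have hℓ : (0 : ℝ) ≤ ℓ := Nat.cast_nonneg ℓ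
  rw [Finset.mem_Icc, cubeIndex]
  refine ⟨Int.le_floor.2 (by push_cast; linarith), ?_⟩
  have := (Int.floor_le (p i)).trans (show p i ≤ ((ℓ : ℤ) : ℝ) by push_cast; linarith)
  exact Int.cast_le.1 this

lemma card_piFinset_Icc_le (d : ℕ) {ℓ : ℕ} (hℓ : 1 ≤ ℓ) :
    (Fintype.piFinset fun _ : Fin d => Finset.Icc (-(ℓ : ℤ)) ℓ).card ≤ 3 ^ d * ℓ ^ d := by
  rw [Fintype.card_piFinset, Finset.prod_const, Finset.card_univ, Fintype.card_fin, ← mul_pow]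
  gcongr
  rw [Int.card_Icc]
  omega

/-- Proposition A.1: polynomial tail bound for `R_{Λ_ℓ}` under the Poisson process. -/
theorem stmt_17 (d : ℕ) (hd : 1 ≤ d) (α ρ : ℝ) (hα : 0 < α) (hρ : 0 < ρ)
    (P : Measure (Config d)) (hP : IsPoissonPP d ρ P) :
    ∃ c₁ : ℝ, ∀ n : ℕ, ∃ Cn : ℝ, 0 < Cn ∧
      ∀ γ : ℝ, c₁ < γ → ∀ ℓ : ℕ, 1 ≤ ℓ →
        P {ξ | ENNReal.ofReal (γ * (ℓ : ℝ) ^ d) ≤ Rfun α (cube d ℓ) ξ} ≤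
          ENNReal.ofReal (Cn / (ℓ : ℝ) ^ (n * d)) := by
  lift ρ to NNReal using hρ.le
  have := hP.1
  set Φ : ℝ := (∑' v, cubeKernel d α v).toReal with hΦ
  have hΦtop := tsum_cubeKernel_ne_top hd hα
  have hΦ0 : 0 ≤ Φ := ENNReal.toReal_nonneg
  set μ := ∫ m : ℕ, (m : ℝ) ^ 2 ∂poissonMeasure ρ with hμ
  have hμ0 : 0 ≤ μ := integral_nonneg fun m => by positivity
  set D : ℝ := 2 * 3 ^ d * Φ with hD
  have hD0 : 0 ≤ D := by positivity
  refine ⟨μ * D + 1, fun n => ?_⟩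
  obtain ⟨C, hC, hmom⟩ := hP.exists_integral_weighted_sum_le (2 * Φ) n
  refine ⟨C * (D + 1) ^ n + 1, by positivity, fun γ hγ ℓ hℓ => ?_⟩
  set N : ℝ := (ℓ : ℝ) ^ d with hN
  have hℓ1 : (1 : ℝ) ≤ ℓ := by exact_mod_cast hℓ
  have hN1 : 1 ≤ N := one_le_pow₀ hℓ1
  set Z := Fintype.piFinset fun _ : Fin d => Finset.Icc (-(ℓ : ℤ)) ℓ with hZ
  set b : (Fin d → ℤ) → ℝ := fun w => (cubeWeight d α Z w).toReal with hb
  have hwtop : ∀ w, cubeWeight d α Z w ≠ ∞ := fun w =>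
    ne_top_of_le_ne_top (ENNReal.mul_ne_top (by simp) hΦtop) (cubeWeight_le d α Z w)
  have hb0 : ∀ w, 0 ≤ b w := fun w => ENNReal.toReal_nonneg
  have hbB : ∀ w, b w ≤ 2 * Φ := fun w => by
    have := ENNReal.toReal_mono (ENNReal.mul_ne_top (by simp) hΦtop) (cubeWeight_le d α Z w)
    simpa using this
  have hbsum : ∀ F : Finset (Fin d → ℤ), ∑ w ∈ F, b w ≤ D * N := fun F => by
    have h1 : ∑ w ∈ F, cubeWeight d α Z w ≤ 2 * Z.card * ∑' v, cubeKernel d α v :=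
      (ENNReal.sum_le_tsum F).trans (tsum_cubeWeight d α Z).le
    have h2 := ENNReal.toReal_mono (ENNReal.mul_ne_top
      (ENNReal.mul_ne_top (by simp) (by simp)) hΦtop) h1
    rw [ENNReal.toReal_sum fun w _ => hwtop w] at h2
    simp only [ENNReal.toReal_mul, ENNReal.toReal_ofNat, ENNReal.toReal_natCast] at h2
    have h3 : (Z.card : ℝ) ≤ 3 ^ d * N := by
      rw [hN, hZ]; exact_mod_cast card_piFinset_Icc_le d hℓ
    calc ∑ w ∈ F, b w ≤ 2 * Z.card * Φ := h2
      _ ≤ 2 * (3 ^ d * N) * Φ := by gcongr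
      _ = D * N := by rw [hD]; ring
  set E : Finset (Fin d → ℤ) → Set (Config d) := fun F =>
    {ξ | (μ * D + 1) * N < ∑ w ∈ F, b w * (cubeCount w ξ : ℝ) ^ 2} with hE
  have hEmono : Monotone E := fun F F' hFF' ξ hξ =>
    lt_of_lt_of_le (show _ < _ from hξ) (Finset.sum_le_sum_of_subset_of_nonneg hFF'
      fun w _ _ => mul_nonneg (hb0 w) (by positivity))
  have hcover : {ξ | ENNReal.ofReal (γ * (ℓ : ℝ) ^ d) ≤ Rfun α (cube d ℓ) ξ} ≤ᵐ[P] ⋃ F, E F := by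
    filter_upwards [hP.2.1] with ξ hξ hmem
    have h1 : ENNReal.ofReal ((μ * D + 1) * N) <
        ∑' w, cubeWeight d α Z w * (cubeCount w ξ : ℝ≥0∞) ^ 2 := by
      refine lt_of_lt_of_le ?_ ((show _ ≤ _ from hmem).trans
        (Rfun_le_tsum_cubeWeight hd hα hξ fun p hp => cubeIndex_mem_piFinset ℓ hp))
      rw [ENNReal.ofReal_lt_ofReal_iff_of_nonneg (by positivity)]
      gcongr
    rw [ENNReal.tsum_eq_iSup_sum] at h1
    obtain ⟨F, hF⟩ := lt_iSup_iff.1 h1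
    refine Set.mem_iUnion.2 ⟨F, ?_⟩
    have h2 : ∑ w ∈ F, cubeWeight d α Z w * (cubeCount w ξ : ℝ≥0∞) ^ 2 =
        ENNReal.ofReal (∑ w ∈ F, b w * (cubeCount w ξ : ℝ) ^ 2) := by
      rw [ENNReal.ofReal_sum_of_nonneg fun w _ => mul_nonneg (hb0 w) (by positivity)]
      refine Finset.sum_congr rfl fun w _ => ?_
      rw [ENNReal.ofReal_mul (hb0 w), ENNReal.ofReal_toReal (hwtop w),
        ENNReal.ofReal_pow (Nat.cast_nonneg _), ENNReal.ofReal_natCast]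
    rw [h2] at hF
    exact (ENNReal.ofReal_lt_ofReal_iff_of_nonneg (by positivity)).1 hF
  refine (measure_mono_ae hcover).trans ?_
  rw [hEmono.measure_iUnion]
  refine iSup_le fun F => ?_
  obtain ⟨hint, hle⟩ := hmom b hb0 hbB F ((D + 1) * N) (by nlinarith)
    ((hbsum F).trans (by nlinarith))
  set S : Config d → ℝ := fun ξ => ∑ w ∈ F, b w * ((cubeCount w ξ : ℝ) ^ 2 - μ) with hS
  have hsub : E F ⊆ {ξ | N ^ (2 * n) ≤ S ξ ^ (2 * n)} := fun ξ hξ => by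
    have h1 : (μ * D + 1) * N < ∑ w ∈ F, b w * (cubeCount w ξ : ℝ) ^ 2 := hξ
    have h2 : S ξ = ∑ w ∈ F, b w * (cubeCount w ξ : ℝ) ^ 2 - (∑ w ∈ F, b w) * μ := by
      simp only [hS, mul_sub, Finset.sum_sub_distrib, Finset.sum_mul]
    have h3 := mul_le_mul_of_nonneg_right (hbsum F) hμ0
    have h4 : N ≤ S ξ := by rw [h2]; linarith
    exact pow_le_pow_left₀ (by linarith) h4 _
  have hmarkov := mul_meas_ge_le_integral_of_nonneg
    (ae_of_all P fun ξ => (even_two_mul n).pow_nonneg (S ξ)) hint (N ^ (2 * n))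
  refine (measure_mono hsub).trans ?_
  rw [← ENNReal.ofReal_toReal (measure_ne_top P {ξ | N ^ (2 * n) ≤ S ξ ^ (2 * n)})]
  refine ENNReal.ofReal_le_ofReal ?_
  have hNn : (ℓ : ℝ) ^ (n * d) = N ^ n := by rw [hN, ← pow_mul, mul_comm]
  rw [hNn, le_div_iff₀ (by positivity)]
  have h4 := hmarkov.trans hle
  rw [measureReal_def, two_mul, pow_add, mul_pow] at h4
  rw [two_mul n, pow_add]
  have h5 : 0 < N ^ n := by positivity
  refine le_of_mul_le_mul_left ?_ h5
  nlinarith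
end
end

section
/- Let d ≥ 2, α > 0, and let P be a simple point process on ℝ^d satisfying Assumptions (A1) and (A2). Then there exists C < ∞ such that, P-a.s. for all sufficiently large L, C^{−1}·L^d ≤ ξ(Λ_L) ≤ C·L^d, where ξ(Λ_L) = #(ξ ∩ Λ_L). -/
open MeasureTheory Filter
open scoped ENNReal

noncomputable section

/-- In a Bernoulli field of parameter `15/16`, the probability that fewer than half of the sites of
a finite set are open is exponentially small in the number of sites. -/
lemma IsBernoulliField.measure_few_open_le {d : ℕ} {ν : Measure ((Fin d → ℤ) → Bool)}
    (hν : IsBernoulliField d (15 / 16) ν) (S : Finset (Fin d → ℤ)) :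
    ν {ω | 2 * (S.filter (fun x => ω x = true)).card < S.card} ≤ (2⁻¹ : ℝ≥0∞) ^ S.card := by
  classical
  set F := S.powerset.filter (fun T => 2 * T.card < S.card) with hF
  have hsub : {ω : (Fin d → ℤ) → Bool | 2 * (S.filter (fun x => ω x = true)).card < S.card} ⊆
      ⋃ T ∈ F, {ω | ∀ x ∈ S, ω x = decide (x ∈ T)} := by
    intro ω hω
    simp only [Set.mem_iUnion]
    refine ⟨S.filter (fun x => ω x = true), ?_, ?_⟩
    · simp only [hF, Finset.mem_filter, Finset.mem_powerset]
      exact ⟨Finset.filter_subset _ _, hω⟩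
    · intro x hx
      cases h : ω x <;> simp [hx, h]
  have hcyl : ∀ T ∈ F, ν {ω | ∀ x ∈ S, ω x = decide (x ∈ T)} ≤ (4⁻¹ : ℝ≥0∞) ^ S.card := by
    intro T hT
    simp only [hF, Finset.mem_filter, Finset.mem_powerset] at hT
    rw [hν.2 S (fun x => decide (x ∈ T))]
    have h16 : ENNReal.ofReal (1 - 15 / 16) = (4⁻¹ : ℝ≥0∞) ^ 2 := by
      rw [← ENNReal.inv_pow, show (1 - 15 / 16 : ℝ) = (16 : ℝ)⁻¹ by norm_num,
        ENNReal.ofReal_inv_of_pos (by norm_num)]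
      norm_num
    calc ∏ x ∈ S, ENNReal.ofReal (if decide (x ∈ T) = true then 15 / 16 else 1 - 15 / 16)
        ≤ ∏ x ∈ S, (if x ∈ T then 1 else (4⁻¹ : ℝ≥0∞) ^ 2) := by
          refine Finset.prod_le_prod' fun x _ => ?_
          by_cases hx : x ∈ T
          · simp only [hx, decide_true, if_true]
            exact ENNReal.ofReal_le_one.2 (by norm_num)
          · simp only [hx, decide_false, if_false, Bool.false_eq_true, h16, le_refl]
      _ = ((4⁻¹ : ℝ≥0∞) ^ 2) ^ (S \ T).card := by
          rw [Finset.prod_ite]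
          simp only [Finset.prod_const_one, one_mul, Finset.prod_const]
          rw [Finset.sdiff_eq_filter]
      _ ≤ (4⁻¹ : ℝ≥0∞) ^ S.card := by
          rw [← pow_mul]
          refine pow_le_pow_of_le_one zero_le (ENNReal.inv_le_one.2 (by norm_num)) ?_
          have := Finset.card_sdiff_add_card_eq_card hT.1
          omega
  have h24 : (2 : ℝ≥0∞) * 4⁻¹ = 2⁻¹ := by
    rw [show (4 : ℝ≥0∞) = 2 * 2 by norm_num, ENNReal.mul_inv (by simp) (by simp), ← mul_assoc,
      ENNReal.mul_inv_cancel (by simp) (by simp), one_mul]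
  calc _ ≤ ν (⋃ T ∈ F, {ω | ∀ x ∈ S, ω x = decide (x ∈ T)}) := measure_mono hsub
    _ ≤ ∑ T ∈ F, ν {ω | ∀ x ∈ S, ω x = decide (x ∈ T)} := measure_biUnion_finset_le _ _
    _ ≤ F.card • (4⁻¹ : ℝ≥0∞) ^ S.card := Finset.sum_le_card_nsmul _ _ _ hcyl
    _ ≤ 2 ^ S.card * (4⁻¹ : ℝ≥0∞) ^ S.card := by
        rw [nsmul_eq_mul]
        gcongr
        have : F.card ≤ 2 ^ S.card :=
          (Finset.card_filter_le _ _).trans (Finset.card_powerset S).le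
        exact_mod_cast this
    _ = (2⁻¹ : ℝ≥0∞) ^ S.card := by rw [← mul_pow, h24]

/-- The discrete box `{0, …, m - 1}^d`. -/
def latticeBox (d m : ℕ) : Finset (Fin d → ℤ) :=
  Fintype.piFinset fun _ => Finset.Ico (0 : ℤ) m

lemma card_latticeBox (d m : ℕ) : (latticeBox d m).card = m ^ d := by
  simp [latticeBox]

lemma IsBernoulliField.eventually_many_open {d : ℕ} (hd : d ≠ 0)
    {ν : Measure ((Fin d → ℤ) → Bool)} (hν : IsBernoulliField d (15 / 16) ν) :
    ∀ᵐ ω ∂ν, ∀ᶠ m : ℕ in atTop,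
      m ^ d ≤ 2 * ((latticeBox d m).filter (fun x => ω x = true)).card := by
  have hsum : ∑' m : ℕ, ν {ω | 2 * ((latticeBox d m).filter (fun x => ω x = true)).card
      < (latticeBox d m).card} ≠ ∞ := by
    refine ne_top_of_le_ne_top (b := ∑' m : ℕ, (2⁻¹ : ℝ≥0∞) ^ m) ?_ ?_
    · rw [ENNReal.tsum_geometric]
      simp
    · refine ENNReal.tsum_le_tsum fun m => (hν.measure_few_open_le _).trans ?_
      refine pow_le_pow_of_le_one zero_le (ENNReal.inv_le_one.2 (by norm_num)) ?_
      rw [card_latticeBox]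
      exact Nat.le_self_pow hd m
  filter_upwards [ae_eventually_notMem hsum] with ω hω
  filter_upwards [hω] with m hm
  rw [← card_latticeBox d m]
  simpa using hm

lemma Kcube_injective_of_mem {d : ℕ} {K : ℝ} (hK : 0 < K) {x y : Fin d → ℤ} {p : Pt d}
    (hx : p ∈ Kcube d K x) (hy : p ∈ Kcube d K y) : x = y := by
  funext i
  obtain ⟨h1, h2⟩ := hx i
  obtain ⟨h3, h4⟩ := hy i
  have h5 : (x i : ℝ) < y i + 1 := by
    refine lt_of_mul_lt_mul_left (a := K) ?_ hK.le
    linarith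
  have h6 : (y i : ℝ) < x i + 1 := by
    refine lt_of_mul_lt_mul_left (a := K) ?_ hK.le
    linarith
  have h7 : x i < y i + 1 := by exact_mod_cast h5
  have h8 : y i < x i + 1 := by exact_mod_cast h6
  omega

lemma Kcube_subset_cube {d m : ℕ} {K L : ℝ} (hK : 0 < K) (hm : K * m ≤ L / 2)
    {x : Fin d → ℤ} (hx : x ∈ latticeBox d m) : Kcube d K x ⊆ cube d L := by
  intro p hp i
  simp only [latticeBox, Fintype.mem_piFinset, Finset.mem_Ico] at hx
  obtain ⟨h0, h1⟩ := hx i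
  obtain ⟨h2, h3⟩ := hp i
  have h0' : (0 : ℝ) ≤ x i := by exact_mod_cast h0
  have h1' : (x i : ℝ) + 1 ≤ m := by exact_mod_cast h1
  have h4 : 0 ≤ K * x i := by positivity
  have h5 : K * (x i + 1) ≤ K * m := by gcongr
  rw [abs_le]
  constructor <;> linarith

lemma isBounded_cube (d : ℕ) (L : ℝ) : Bornology.IsBounded (cube d L) := by
  refine ((PiLp.antilipschitzWith_ofLp 2 (fun _ : Fin d => ℝ)).isBounded_preimage
    (Metric.isBounded_closedBall (x := (0 : Fin d → ℝ)) (r := |L / 2|))).subset ?_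
  intro p hp
  simp only [Set.mem_preimage, mem_closedBall_zero_iff]
  rw [pi_norm_le_iff_of_nonneg (abs_nonneg _)]
  exact fun i => (hp i).trans (le_abs_self _)

lemma measurableSet_cube (d : ℕ) (L : ℝ) : MeasurableSet (cube d L) := by
  have : cube d L = ⋂ i, {p : Pt d | |p i| ≤ L / 2} := by
    ext p
    simp [cube]
  rw [this]
  refine MeasurableSet.iInter fun i => ?_
  exact (isClosed_le (by fun_prop) continuous_const).measurableSet

lemma measurable_ncard_inter {d : ℕ} {A : Set (Pt d)} (hb : Bornology.IsBounded A)
    (hA : MeasurableSet A) : Measurable fun ξ : Config d => (ξ ∩ A).ncard := by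
  refine measurable_to_countable' fun n => ?_
  exact MeasurableSpace.measurableSet_generateFrom ⟨A, n, hb, hA, rfl⟩

lemma card_le_ncard_of_nonempty {d m : ℕ} {K L : ℝ} (hK : 0 < K) (hm : K * m ≤ L / 2)
    {ξ : Config d} (hξ : IsLocallyFinite ξ) {T : Finset (Fin d → ℤ)} (hT : T ⊆ latticeBox d m)
    (h : ∀ x ∈ T, (ξ ∩ Kcube d K x).Nonempty) : T.card ≤ (ξ ∩ cube d L).ncard := by
  choose! f hf using h
  rw [← Set.ncard_coe_finset]
  refine Set.ncard_le_ncard_of_injOn f ?_ ?_ (hξ _ (isBounded_cube d L))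
  · exact fun x hx => ⟨(hf x hx).1, Kcube_subset_cube hK hm (hT hx) (hf x hx).2⟩
  · intro x hx y hy hxy
    refine Kcube_injective_of_mem hK (hf x hx).2 ?_
    rw [hxy]
    exact (hf y hy).2

theorem AssumptionA1.eventually_le_ncard {d : ℕ} (hd : d ≠ 0) {P : Measure (Config d)}
    (hP : IsPointProcess P) (hA1 : AssumptionA1 P) :
    ∃ c : ℝ, 0 < c ∧ ∀ᵐ ξ ∂P, ∀ᶠ L : ℕ in atTop,
      c * (L : ℝ) ^ d ≤ ((ξ ∩ cube d L).ncard : ℝ) := by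
  obtain ⟨K, hK, μ, ν, -, hν, hfst, hsnd, hdom⟩ := hA1 (15 / 16) (by norm_num) (by norm_num)
  refine ⟨(1 / (4 * K)) ^ d / 2, by positivity, ?_⟩
  have hmeas : MeasurableSet {ξ : Config d | ∀ᶠ L : ℕ in atTop,
      (1 / (4 * K)) ^ d / 2 * (L : ℝ) ^ d ≤ ((ξ ∩ cube d L).ncard : ℝ)} := by
    simp only [eventually_atTop, Set.ofPred_exists, Set.ofPred_forall]
    refine MeasurableSet.iUnion fun _ => MeasurableSet.iInter fun L =>
      MeasurableSet.iInter fun _ => ?_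
    have h : Measurable fun ξ : Config d => (((ξ ∩ cube d L).ncard : ℕ) : ℝ) :=
      (measurable_from_top (f := fun n : ℕ => (n : ℝ))).comp
        (measurable_ncard_inter (isBounded_cube d L) (measurableSet_cube d L))
    exact measurableSet_le measurable_const h
  have hlf : ∀ᵐ ω ∂μ, IsLocallyFinite ω.1 :=
    ae_of_ae_map measurable_fst.aemeasurable (hfst ▸ hP.2)
  have hopen : ∀ᵐ ω ∂μ, ∀ᶠ m : ℕ in atTop,
      m ^ d ≤ 2 * ((latticeBox d m).filter (fun x => ω.2 x = true)).card :=
    ae_of_ae_map (f := Prod.snd) measurable_snd.aemeasurable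
      (hsnd ▸ hν.eventually_many_open hd)
  rw [← hfst]
  refine (ae_map_iff measurable_fst.aemeasurable hmeas).2 ?_
  filter_upwards [hlf, hopen, hdom] with ω h1 h2 h3
  have htend : Tendsto (fun L : ℕ => ⌊(L : ℝ) / (2 * K)⌋₊) atTop atTop :=
    tendsto_nat_floor_atTop.comp
      (tendsto_natCast_atTop_atTop.atTop_div_const (by positivity))
  filter_upwards [htend.eventually h2, tendsto_natCast_atTop_atTop.eventually_ge_atTop (4 * K)]
    with L hL hLK
  set m := ⌊(L : ℝ) / (2 * K)⌋₊ with hm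
  have hm1 : (m : ℝ) ≤ L / (2 * K) := Nat.floor_le (by positivity)
  have hm2 : (L : ℝ) / (2 * K) < m + 1 := Nat.lt_floor_add_one _
  have hm3 : K * m ≤ L / 2 := by
    rw [le_div_iff₀ (by positivity)] at hm1
    linarith
  have hm4 : 1 / (4 * K) * L ≤ m := by
    have h5 : (1 : ℝ) ≤ 1 / (4 * K) * L := by
      rw [one_div, inv_mul_eq_div, le_div_iff₀ (by positivity)]
      linarith
    have h6 : (L : ℝ) / (2 * K) = 2 * (1 / (4 * K) * L) := by
      field_simp
      norm_num
    linarith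
  have hcard := card_le_ncard_of_nonempty (L := L) hK hm3 h1
    (Finset.filter_subset (fun x => ω.2 x = true) (latticeBox d m))
    (fun x hx => h3 x (Finset.mem_filter.1 hx).2)
  have hfin : ((m : ℝ)) ^ d ≤ 2 * ((ω.1 ∩ cube d L).ncard : ℝ) := by
    exact_mod_cast hL.trans (Nat.mul_le_mul_left 2 hcard)
  have hpow : (1 / (4 * K) * (L : ℝ)) ^ d ≤ (m : ℝ) ^ d := by gcongr
  rw [mul_pow] at hpow
  linarith

lemma encard_le_Rfun {d : ℕ} {α : ℝ} (hα : α ≠ 0) (A : Set (Pt d)) (ξ : Config d) :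
    ((ξ ∩ A).encard : ℝ≥0∞) ≤ Rfun α A ξ := by
  rw [← ENNReal.tsum_set_one]
  refine ENNReal.tsum_le_tsum fun x => ?_
  refine le_trans ?_ (ENNReal.le_tsum (⟨x, x.2.1⟩ : ↥ξ))
  simp [Real.zero_rpow hα]

lemma ncard_le_of_Rfun_le {d : ℕ} {α : ℝ} (hα : α ≠ 0) {A : Set (Pt d)} {ξ : Config d}
    {r : ℝ} (hr : 0 ≤ r) (h : Rfun α A ξ ≤ ENNReal.ofReal r) : ((ξ ∩ A).ncard : ℝ) ≤ r := by
  have h1 : ((ξ ∩ A).ncard : ℝ≥0∞) ≤ ENNReal.ofReal r := by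
    refine le_trans ?_ ((encard_le_Rfun hα A ξ).trans h)
    exact_mod_cast ENat.toENNReal_le.2 (Set.ncard_le_encard (ξ ∩ A))
  rw [← ENNReal.ofReal_natCast] at h1
  exact (ENNReal.ofReal_le_ofReal_iff hr).1 h1

lemma exists_mem_Vcube {d L : ℕ} (hL : 4 ≤ L) {p : Pt d} (hp : p ∈ cube d L) :
    ∃ x ∈ Fintype.piFinset fun _ : Fin d =>
      Finset.Icc (-(⌈(L : ℝ) ^ (1 / 2 : ℝ)⌉₊ : ℤ)) ⌈(L : ℝ) ^ (1 / 2 : ℝ)⌉₊,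
      p ∈ Vcube d L (1 / 2) x := by
  have hL' : (4 : ℝ) ≤ L := by exact_mod_cast hL
  set s := (L : ℝ) ^ (1 / 2 : ℝ) with hs
  have hs0 : 0 < s := by positivity
  have hss : s * s = L := by
    rw [hs, ← Real.sqrt_eq_rpow, Real.mul_self_sqrt (by positivity)]
  have hs2 : 2 ≤ s := by nlinarith
  have hceil : s ≤ (⌈s⌉₊ : ℝ) := Nat.le_ceil s
  refine ⟨fun i => ⌊p i / s⌋, ?_, ?_⟩
  · simp only [Fintype.mem_piFinset, Finset.mem_Icc]
    intro i
    obtain ⟨h1, h2⟩ := abs_le.1 (hp i)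
    constructor
    · rw [Int.le_floor, le_div_iff₀ hs0]
      push_cast
      nlinarith
    · have h3 : (⌊p i / s⌋ : ℝ) ≤ ((⌈s⌉₊ : ℤ) : ℝ) := by
        refine (Int.floor_le _).trans ?_
        rw [div_le_iff₀ hs0]
        push_cast
        nlinarith
      exact_mod_cast h3
  · intro i
    have h1 : (⌊p i / s⌋ : ℝ) ≤ p i / s := Int.floor_le _
    have h2 : p i / s < ⌊p i / s⌋ + 1 := Int.lt_floor_add_one _
    rw [le_div_iff₀ hs0] at h1
    rw [div_lt_iff₀ hs0] at h2
    constructor <;> linarith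

theorem AssumptionA2.eventually_ncard_le {d : ℕ} {α : ℝ} (hα : α ≠ 0) {P : Measure (Config d)}
    (hP : IsPointProcess P) (hA2 : AssumptionA2 α P) :
    ∃ C : ℝ, 0 < C ∧ ∀ᵐ ξ ∂P, ∀ᶠ L : ℕ in atTop,
      ((ξ ∩ cube d L).ncard : ℝ) ≤ C * (L : ℝ) ^ d := by
  obtain ⟨C, hC, h⟩ := hA2 (1 / 2) (by norm_num) (by norm_num)
  refine ⟨5 ^ d * C, by positivity, ?_⟩
  filter_upwards [h, hP.2] with ξ hξ hlf
  filter_upwards [hξ, eventually_ge_atTop 4] with L hR hL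
  have hL' : (4 : ℝ) ≤ L := by exact_mod_cast hL
  set F := Fintype.piFinset fun _ : Fin d =>
    Finset.Icc (-(⌈(L : ℝ) ^ (1 / 2 : ℝ)⌉₊ : ℤ)) ⌈(L : ℝ) ^ (1 / 2 : ℝ)⌉₊ with hF
  have hcover : ξ ∩ cube d L ⊆ ⋃ x ∈ F, (ξ ∩ cube d L) ∩ Vcube d L (1 / 2) x := by
    intro p hp
    obtain ⟨x, hx, hpx⟩ := exists_mem_Vcube hL hp.2
    simp only [Set.mem_iUnion]
    exact ⟨x, hx, hp, hpx⟩
  have hfin : (ξ ∩ cube d L).Finite := hlf _ (isBounded_cube d L)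
  have hbound : ∀ x ∈ F, (((ξ ∩ cube d L) ∩ Vcube d L (1 / 2) x).ncard : ℝ) ≤
      C * (L : ℝ) ^ ((1 / 2 : ℝ) * d) := by
    intro x _
    rcases Set.eq_empty_or_nonempty ((ξ ∩ cube d L) ∩ Vcube d L (1 / 2) x) with he | ⟨p, hp⟩
    · rw [he]
      simp only [Set.ncard_empty, Nat.cast_zero]
      positivity
    · have hr := hR x ⟨p, hp.2, hp.1.2⟩
      have hb : Rfun α (cube d L ∩ Vcube d L (1 / 2) x) ξ ≤ Rfun α (Vcube d L (1 / 2) x) ξ :=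
        ENNReal.tsum_comp_le_tsum_of_injective
          (Set.inclusion_injective (Set.inter_subset_inter_right ξ Set.inter_subset_right))
          (fun y : ↥(ξ ∩ Vcube d L (1 / 2) x) => ∑' z : ↥ξ,
            ENNReal.ofReal (Real.exp (-(dist (y : Pt d) (z : Pt d)) ^ α)))
      rw [Set.inter_assoc]
      exact ncard_le_of_Rfun_le hα (by positivity) (hb.trans hr)
  set s := (L : ℝ) ^ (1 / 2 : ℝ) with hs
  have hs0 : 0 < s := by positivity
  have hss : s * s = L := by
    rw [hs, ← Real.sqrt_eq_rpow, Real.mul_self_sqrt (by positivity)]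
  have hs2 : 2 ≤ s := by nlinarith
  have hcard : (F.card : ℝ) ≤ (5 * s) ^ d := by
    have h1 : F.card = (2 * ⌈s⌉₊ + 1) ^ d := by
      rw [hF, Fintype.card_piFinset]
      simp only [Int.card_Icc, Finset.prod_const, Finset.card_univ, Fintype.card_fin]
      congr 1
      omega
    rw [h1]
    push_cast
    have h2 : (⌈s⌉₊ : ℝ) < s + 1 := Nat.ceil_lt_add_one hs0.le
    gcongr
    linarith
  have hpow : (L : ℝ) ^ ((1 / 2 : ℝ) * d) = s ^ d := by
    rw [Real.rpow_mul_natCast (by positivity)]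
  have hsub : (ξ ∩ cube d L).ncard ≤ ∑ x ∈ F, ((ξ ∩ cube d L) ∩ Vcube d L (1 / 2) x).ncard := by
    refine (Set.ncard_le_ncard hcover ?_).trans (Finset.set_ncard_biUnion_le _ _)
    exact hfin.subset (Set.iUnion₂_subset fun _ _ => Set.inter_subset_left)
  calc ((ξ ∩ cube d L).ncard : ℝ)
      ≤ ∑ x ∈ F, (((ξ ∩ cube d L) ∩ Vcube d L (1 / 2) x).ncard : ℝ) := by exact_mod_cast hsub
    _ ≤ F.card • (C * (L : ℝ) ^ ((1 / 2 : ℝ) * d)) := Finset.sum_le_card_nsmul _ _ _ hbound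
    _ ≤ (5 * s) ^ d * (C * s ^ d) := by
        rw [nsmul_eq_mul, hpow]
        gcongr
    _ = 5 ^ d * C * (L : ℝ) ^ d := by
        rw [← hss, mul_pow, mul_pow]
        ring

/-- (1.5): under (A1) and (A2), `C⁻¹ L^d ≤ ξ(Λ_L) ≤ C L^d` a.s. eventually. -/
theorem stmt_19 {d : ℕ} (hd : 2 ≤ d) (α : ℝ) (hα : 0 < α)
    (P : Measure (Config d)) (hP : IsPointProcess P)
    (hA1 : AssumptionA1 P) (hA2 : AssumptionA2 α P) :
    ∃ C : ℝ, 0 < C ∧ ∀ᵐ ξ ∂P, ∀ᶠ L : ℕ in atTop,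
      C⁻¹ * (L : ℝ) ^ d ≤ ((ξ ∩ cube d L).ncard : ℝ) ∧
      ((ξ ∩ cube d L).ncard : ℝ) ≤ C * (L : ℝ) ^ d := by
  obtain ⟨c, hc, hlow⟩ := hA1.eventually_le_ncard (by omega) hP
  obtain ⟨C, hC, hupp⟩ := hA2.eventually_ncard_le hα.ne' hP
  have hmax : 0 < max c⁻¹ C := lt_max_of_lt_right hC
  refine ⟨max c⁻¹ C, hmax, ?_⟩
  filter_upwards [hlow, hupp] with ξ h1 h2
  filter_upwards [h1, h2] with L h3 h4
  constructor
  · refine le_trans ?_ h3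
    gcongr
    exact inv_le_of_inv_le₀ hc (le_max_left _ _)
  · refine h4.trans ?_
    gcongr
    exact le_max_right _ _

end
end
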